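/- Let K = ℚ(√-5), let a = √-5 ∈ K, and let σ be the nontrivial automorphism of K over ℚ. In K(t)[x] (t the generator of the rational function field), set f_A(t,x) = 5^3·(24a·x^2 + 16a·x - 648a - x^4 - 60x^3 - 870x^2 - 220x + 6399)^3 - 2^12·3^15·(118a - 475)·t·x^2, and let f_{A2}(t,x) = f_A(t,x)·(σf_A)(t,x), where σf_A is obtained by applying σ to all coefficients. Then f_{A2} has all coefficients in ℚ(t), and the Galois group of f_{A2} over ℚ(t) has cardinality 190080 (the order of the group M₁₂.2 = Aut(M₁₂)). -/

import Mathlib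

open Polynomial

section PermutationCounting

variable {α : Type*}

theorem Equiv.Perm.prime_dvd_card_of_no_fixed_points [DecidableEq α] (σ : Equiv.Perm α) (S :
    Finset α)
    (hS : ∀ x ∈ S, σ x ∈ S) (p m : ℕ) (hp : p.Prime) (h1 : σ ^ p ^ m = 1)
    (hfix : ∀ x ∈ S, σ x ≠ x) : p ∣ S.card := by
  have := Fact.mk hp
  have hiff : ∀ x, σ x ∈ S ↔ x ∈ S := by
    intro x
    refine ⟨fun h => ?_, hS x⟩
    have hpow : ∀ n : ℕ, ∀ y ∈ S, (σ ^ n) y ∈ S := by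
      intro n
      induction n with
      | zero => intro y hy; simpa using hy
      | succ k ih => intro y hy; rw [pow_succ, Equiv.Perm.mul_apply]; exact ih _ (hS y hy)
    have h2 := hpow (p ^ m - 1) _ h
    rw [← Equiv.Perm.mul_apply, ← pow_succ, Nat.sub_add_cancel (Nat.one_le_pow _ _ hp.pos),
        h1] at h2
    simpa using h2
  have h2 : (σ.subtypePerm (p := fun x => x ∈ S) hiff) ^ p ^ m = 1 := by
    rw [Equiv.Perm.subtypePerm_pow]
    ext x
    simp [h1]
  have h3 := Equiv.Perm.card_compl_support_modEq h2
  have h4 : (σ.subtypePerm (p := fun x => x ∈ S) hiff).supportᶜ = ∅ := by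
    ext x
    simpa [Subtype.ext_iff] using hfix x x.2
  rw [h4] at h3
  simpa [Nat.modEq_iff_dvd, Nat.ModEq, Nat.dvd_iff_mod_eq_zero, eq_comm] using h3

theorem Equiv.Perm.four_dvd_card_of_sq_no_fixed_points (σ : Equiv.Perm α) (S : Finset α)
    (hS : ∀ x ∈ S, σ x ∈ S) (h1 : σ ^ 4 = 1)
    (hfix : ∀ x ∈ S, (σ ^ 2) x ≠ x) : 4 ∣ S.card := by
  have hfix1 : ∀ x ∈ S, σ x ≠ x := fun x hx h => hfix x hx (by simp [pow_two, h])
  have hiff : ∀ x, σ x ∈ S ↔ x ∈ S := by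
    intro x
    refine ⟨fun h => ?_, hS x⟩
    have h2 := hS _ (hS _ (hS _ h))
    have : σ (σ (σ (σ x))) = x := by
      have := congrArg (fun f => f x) h1
      simpa [pow_succ] using this
    rwa [this] at h2
  set τ := σ.subtypePerm (p := fun x => x ∈ S) hiff with hτ
  have hτ4 : τ ^ 4 = 1 := by
    rw [hτ, Equiv.Perm.subtypePerm_pow]
    ext x
    simp [h1]
  have hτfix : ∀ x, (τ ^ 2) x ≠ x := by
    intro x h
    rw [hτ, Equiv.Perm.subtypePerm_pow] at h
    exact hfix x x.2 (by simpa [Subtype.ext_iff] using h)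
  rcases S.eq_empty_or_nonempty with he | ⟨x0, hx0⟩
  · simp [he]
  have hord : orderOf τ = 4 := by
    have := orderOf_eq_prime_pow (x := τ) (p := 2) (n := 1) (fun h => ?_) (by simpa using hτ4)
    · simpa using this
    · apply hτfix ⟨x0, hx0⟩
      rw [show (2 : ℕ) ^ 1 = 2 by norm_num] at h
      rw [h]; rfl
  have hstab : ∀ b : {x // x ∈ S}, MulAction.stabilizer (Subgroup.zpowers τ) b = ⊥ := by
    intro b
    rw [eq_bot_iff]
    rintro ⟨g, hg⟩ hgb
    rw [MulAction.mem_stabilizer_iff] at hgb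
    have hgb' : g b = b := hgb
    obtain ⟨k, hk⟩ := (Subgroup.mem_zpowers_iff).1 hg
    obtain ⟨n, hn⟩ : ∃ n : ℕ, n < 4 ∧ τ ^ n = g := by
      refine ⟨(k % 4).toNat, by omega, ?_⟩
      rw [← hk, ← zpow_natCast, Int.toNat_of_nonneg (by omega),
        ← zpow_mod_orderOf τ k, hord]; rfl
    have hn0 : n = 0 ∨ (g ^ 1 = τ ^ 2 ∨ g ^ 2 = τ ^ 2) := by
      obtain ⟨h, rfl⟩ := hn
      interval_cases n
      · simp
      · simp
      · simp
      · right; right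
        rw [← pow_mul, show 3 * 2 = 4 + 2 by norm_num, pow_add, hτ4, one_mul]
    rcases hn0 with h | h | h
    · rw [Subgroup.mem_bot, Subtype.ext_iff]
      simp [← hn.2, h]
    · exfalso; apply hτfix b; rw [← h]; simpa using hgb'
    · exfalso; apply hτfix b; rw [← h]; simp [pow_two, hgb']
  have e := MulAction.selfEquivOrbitsQuotientProd hstab
  have hc := Nat.card_congr e
  rw [Nat.card_prod, Nat.card_zpowers, hord] at hc
  rw [show S.card = Nat.card {x // x ∈ S} by simp, hc]
  exact dvd_mul_left _ _

end PermutationCounting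

section MultipleTransitivity

open Function

/-- `H` acts transitively on injective `k`-tuples. -/
def IsTupleTransitive (H : Subgroup (Equiv.Perm (Fin 12))) (k : ℕ) : Prop :=
  ∀ u v : Fin k → Fin 12, Injective u → Injective v → ∃ g ∈ H, ∀ i, g (u i) = v i

open Classical in
/-- The orbit of `x` under the pointwise stabilizer of the tuple `u`. -/
noncomputable def stabOrbit (H : Subgroup (Equiv.Perm (Fin 12))) {k : ℕ} (u : Fin k → Fin 12)
    (x : Fin 12) : Finset (Fin 12) :=
  Finset.univ.filter fun y => ∃ g ∈ H, (∀ i, g (u i) = u i) ∧ g x = y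

variable {H : Subgroup (Equiv.Perm (Fin 12))} {k : ℕ} {u : Fin k → Fin 12} {x : Fin 12}

theorem mem_stabOrbit {y : Fin 12} :
    y ∈ stabOrbit H u x ↔ ∃ g ∈ H, (∀ i, g (u i) = u i) ∧ g x = y := by
  simp [stabOrbit]

theorem self_mem_stabOrbit : x ∈ stabOrbit H u x :=
  mem_stabOrbit.2 ⟨1, H.one_mem, by simp, by simp⟩

theorem apply_mem_stabOrbit {τ : Equiv.Perm (Fin 12)} (hτ : τ ∈ H) (hu : ∀ i, τ (u i) = u i)
    {y : Fin 12} (hy : y ∈ stabOrbit H u x) : τ y ∈ stabOrbit H u x := by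
  obtain ⟨g, hg, hgu, rfl⟩ := mem_stabOrbit.1 hy
  exact mem_stabOrbit.2 ⟨τ * g, H.mul_mem hτ hg, by simp [hgu, hu], by simp⟩

theorem notMem_stabOrbit (hx : x ∉ Set.range u) (i : Fin k) : u i ∉ stabOrbit H u x := by
  intro h
  obtain ⟨g, hg, hgu, h1⟩ := mem_stabOrbit.1 h
  rw [← hgu i] at h1
  exact hx ⟨i, (g.injective h1).symm⟩

theorem stabOrbit_subset (hx : x ∉ Set.range u) :
    stabOrbit H u x ⊆ (Finset.univ.image u)ᶜ := by
  intro y hy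
  rw [Finset.mem_compl, Finset.mem_image]
  rintro ⟨i, -, rfl⟩
  exact notMem_stabOrbit hx i hy

theorem card_compl_image (hu : Injective u) : ((Finset.univ.image u)ᶜ).card = 12 - k := by
  rw [Finset.card_compl, Finset.card_image_of_injective _ hu]
  simp

theorem card_stabOrbit_le (hu : Injective u) (hx : x ∉ Set.range u) :
    (stabOrbit H u x).card ≤ 12 - k := by
  rw [← card_compl_image hu]
  exact Finset.card_le_card (stabOrbit_subset hx)

theorem card_stabOrbit_pos : 0 < (stabOrbit H u x).card :=
  Finset.card_pos.2 ⟨x, self_mem_stabOrbit⟩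

theorem IsTupleTransitive.succ (hk : IsTupleTransitive H k) (hu : Injective u)
    (hx : x ∉ Set.range u) (hcard : (stabOrbit H u x).card = 12 - k) :
    IsTupleTransitive H (k + 1) := by
  have hfull : stabOrbit H u x = (Finset.univ.image u)ᶜ :=
    Finset.eq_of_subset_of_card_le (stabOrbit_subset hx) (by rw [hcard, card_compl_image hu])
  have key : ∀ v : Fin (k + 1) → Fin 12, Injective v →
      ∃ g ∈ H, (∀ i, g (u i) = v i.castSucc) ∧ g x = v (Fin.last k) := by
    intro v hv
    obtain ⟨g, hg, hgu⟩ := hk u (fun i => v i.castSucc) hu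
      (hv.comp (Fin.castSucc_injective k))
    have : g⁻¹ (v (Fin.last k)) ∈ stabOrbit H u x := by
      rw [hfull, Finset.mem_compl, Finset.mem_image]
      rintro ⟨i, -, h⟩
      have h2 : g (u i) = v (Fin.last k) := by rw [h]; simp
      rw [hgu] at h2
      exact absurd (hv h2) (Fin.castSucc_lt_last i).ne
    obtain ⟨s, hs, hsu, hsx⟩ := mem_stabOrbit.1 this
    refine ⟨g * s, H.mul_mem hg hs, fun i => by simp [hsu, hgu], ?_⟩
    simp [hsx]
  intro v w hv hw
  obtain ⟨g, hg, hgu, hgx⟩ := key v hv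
  obtain ⟨s, hs, hsu, hsx⟩ := key w hw
  refine ⟨s * g⁻¹, H.mul_mem hs (H.inv_mem hg), fun i => ?_⟩
  refine Fin.lastCases ?_ (fun i => ?_) i
  · rw [← hgx, ← hsx]; simp
  · rw [← hgu, ← hsu]; simp

theorem exists_tuple_of_card {S : Finset (Fin 12)} (hS : S.card = k) :
    ∃ v : Fin k → Fin 12, Injective v ∧ ∀ y, y ∈ S ↔ ∃ i, v i = y := by
  refine ⟨S.orderEmbOfFin hS, (S.orderEmbOfFin hS).injective, fun y => ?_⟩
  rw [← Finset.mem_coe, ← Finset.range_orderEmbOfFin S hS, Set.mem_range]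

/-- The number of fixed points of a permutation. -/
def fixCount (τ : Equiv.Perm (Fin 12)) : ℕ := (Finset.univ.filter fun y => τ y = y).card

theorem exists_tuple_of_fixCount {τ : Equiv.Perm (Fin 12)} (h : fixCount τ = k) :
    ∃ v : Fin k → Fin 12, Injective v ∧ ∀ y, τ y = y ↔ ∃ i, v i = y := by
  obtain ⟨v, hv, h1⟩ := exists_tuple_of_card h
  exact ⟨v, hv, fun y => by simpa using h1 y⟩

theorem conj_pow_apply (g τ : Equiv.Perm (Fin 12)) (n : ℕ) (y : Fin 12) :
    ((g⁻¹ * τ * g) ^ n) y = g⁻¹ ((τ ^ n) (g y)) := by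
  have := conj_pow (i := n) (a := g⁻¹) (b := τ)
  rw [inv_inv] at this
  rw [this]; simp

theorem conj_pow_apply_eq_iff (g τ : Equiv.Perm (Fin 12)) (n : ℕ) (y : Fin 12) :
    ((g⁻¹ * τ * g) ^ n) y = y ↔ (τ ^ n) (g y) = g y := by
  rw [conj_pow_apply, Equiv.Perm.inv_eq_iff_eq, eq_comm]

theorem conj_pow_eq_one (g : Equiv.Perm (Fin 12)) {τ : Equiv.Perm (Fin 12)} {n : ℕ}
    (h : τ ^ n = 1) : (g⁻¹ * τ * g) ^ n = 1 := by
  ext y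
  rw [conj_pow_apply, h]; simp

theorem IsTupleTransitive.exists_conj_fixing (hk : IsTupleTransitive H k) (hu : Injective u)
    {τ : Equiv.Perm (Fin 12)} {n : ℕ} (h : fixCount (τ ^ n) = k) :
    ∃ g ∈ H, ∀ y, ((g⁻¹ * τ * g) ^ n) y = y ↔ ∃ i, u i = y := by
  obtain ⟨v, hv, hv1⟩ := exists_tuple_of_fixCount h
  obtain ⟨g, hg, hgu⟩ := hk u v hu hv
  refine ⟨g, hg, fun y => ?_⟩
  rw [conj_pow_apply_eq_iff, hv1]
  refine exists_congr fun i => ?_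
  rw [← hgu]
  exact g.injective.eq_iff

theorem exists_notMem_range (hk : k < 12) (u : Fin k → Fin 12) : ∃ x, x ∉ Set.range u := by
  by_contra! h
  have := Fintype.card_le_of_surjective u h
  simp at this
  omega

/-- Cycle data of suitable elements of a permutation group on twelve points. -/
structure CycleData (H : Subgroup (Equiv.Perm (Fin 12))) : Prop where
  eleven : ∃ τ ∈ H, fixCount τ = 1 ∧ τ ^ 11 = 1
  ten : ∃ τ ∈ H, fixCount τ = 0 ∧ fixCount (τ ^ 2) = 2 ∧ τ ^ 10 = 1
  eight : ∃ τ ∈ H, fixCount τ = 2 ∧ fixCount (τ ^ 2) = 4 ∧ fixCount (τ ^ 4) = 4 ∧ τ ^ 8 = 1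
  six : ∃ τ ∈ H, fixCount (τ ^ 2) = 3 ∧ τ ^ 6 = 1

theorem CycleData.one_transitive (hH : CycleData H) : IsTupleTransitive H 1 := by
  obtain ⟨τ, hτ, hfix, hpow⟩ := hH.eleven
  obtain ⟨σ, hσ, hσfix, -, -⟩ := hH.ten
  obtain ⟨v, hv, hv1⟩ := exists_tuple_of_fixCount hfix
  obtain ⟨x, hx⟩ := exists_notMem_range (by norm_num) v
  have h0 : IsTupleTransitive H 0 := fun u v _ _ => ⟨1, H.one_mem, fun i => i.elim0⟩
  have hu : Injective (Fin.elim0 : Fin 0 → Fin 12) := fun i => i.elim0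
  have hx0 : x ∉ Set.range (Fin.elim0 : Fin 0 → Fin 12) := by simp
  refine h0.succ hu hx0 ?_
  set S := stabOrbit H (Fin.elim0 : Fin 0 → Fin 12) x with hS
  have hle := card_stabOrbit_le (H := H) hu hx0
  have hd : 11 ∣ (S.filter fun y => τ y ≠ y).card := by
    refine Equiv.Perm.prime_dvd_card_of_no_fixed_points τ _ ?_ 11 1 (by norm_num)
      (by simpa using hpow) (by simp)
    intro y hy
    rw [Finset.mem_filter] at hy ⊢
    exact ⟨apply_mem_stabOrbit hτ (fun i => i.elim0) hy.1, fun h => hy.2 (τ.injective h)⟩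
  have hpos : 0 < (S.filter fun y => τ y ≠ y).card := by
    refine Finset.card_pos.2 ⟨x, Finset.mem_filter.2 ⟨self_mem_stabOrbit, fun h => hx ?_⟩⟩
    exact (hv1 x).1 h
  have h11 := Nat.le_of_dvd hpos hd
  have hle2 : (S.filter fun y => τ y ≠ y).card ≤ S.card := Finset.card_filter_le _ _
  rw [← hS] at hle
  by_contra hne
  have hc : Sᶜ.card = 1 := by rw [Finset.card_compl, Fintype.card_fin]; omega
  obtain ⟨y, hy⟩ := Finset.card_eq_one.1 hc
  have hyc : σ y ∈ Sᶜ := by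
    have : y ∈ Sᶜ := by simp [hy]
    rw [Finset.mem_compl] at this ⊢
    intro h
    apply this
    have := apply_mem_stabOrbit (H.inv_mem hσ) (fun i => i.elim0) h
    simpa using this
  rw [hy, Finset.mem_singleton] at hyc
  rw [fixCount, Finset.card_eq_zero] at hσfix
  have : y ∈ Finset.univ.filter fun y => σ y = y := by simp [hyc]
  rw [hσfix] at this
  simp at this

theorem dvd_card_stabOrbit {τ : Equiv.Perm (Fin 12)} (hτ : τ ∈ H)
    (hfix : ∀ y, τ y = y ↔ ∃ i, u i = y) (hx : x ∉ Set.range u) {p : ℕ} (m : ℕ) (hp : p.Prime)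
    (hpow : τ ^ p ^ m = 1) : p ∣ (stabOrbit H u x).card := by
  refine Equiv.Perm.prime_dvd_card_of_no_fixed_points τ _ ?_ p m hp hpow ?_
  · intro y hy
    exact apply_mem_stabOrbit hτ (fun i => (hfix _).2 ⟨i, rfl⟩) hy
  · intro y hy h
    obtain ⟨i, rfl⟩ := (hfix y).1 h
    exact notMem_stabOrbit hx i hy

theorem CycleData.two_transitive (hH : CycleData H) : IsTupleTransitive H 2 := by
  obtain ⟨τ, hτ, hfix, hpow⟩ := hH.eleven
  obtain ⟨u, hu, hu1⟩ := exists_tuple_of_fixCount hfix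
  obtain ⟨x, hx⟩ := exists_notMem_range (by norm_num) u
  refine hH.one_transitive.succ hu hx ?_
  have h := dvd_card_stabOrbit hτ hu1 hx (p := 11) 1 (by norm_num) (by simpa using hpow)
  have h1 := card_stabOrbit_le (H := H) hu hx
  have h2 := card_stabOrbit_pos (H := H) (u := u) (x := x)
  omega

theorem CycleData.three_transitive (hH : CycleData H) : IsTupleTransitive H 3 := by
  obtain ⟨τ, hτ, -, hfix, hpow⟩ := hH.ten
  obtain ⟨u, hu, hu1⟩ := exists_tuple_of_fixCount hfix
  obtain ⟨x, hx⟩ := exists_notMem_range (by norm_num) u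
  refine hH.two_transitive.succ hu hx ?_
  have h := dvd_card_stabOrbit (H.pow_mem hτ 2) hu1 hx (p := 5) 1 (by norm_num)
    (by rw [← pow_mul]; exact hpow)
  obtain ⟨σ, hσ, hσ1, -, -, hσ8⟩ := hH.eight
  obtain ⟨g, hg, hg1⟩ := hH.two_transitive.exists_conj_fixing hu (τ := σ) (n := 1)
    (by simpa using hσ1)
  have h' := dvd_card_stabOrbit (τ := g⁻¹ * σ * g) (H.mul_mem (H.mul_mem (H.inv_mem hg) hσ) hg)
    (by simpa using hg1) hx (p := 2) 3 (by norm_num) (conj_pow_eq_one g hσ8)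
  have h1 := card_stabOrbit_le (H := H) hu hx
  have h2 := card_stabOrbit_pos (H := H) (u := u) (x := x)
  omega

theorem pow_four_apply_eq_iff {σ : Equiv.Perm (Fin 12)} (h2 : fixCount (σ ^ 2) = 4)
    (h4 : fixCount (σ ^ 4) = 4) (y : Fin 12) : (σ ^ 4) y = y ↔ (σ ^ 2) y = y := by
  have hsub : (Finset.univ.filter fun y => (σ ^ 2) y = y) ⊆
      Finset.univ.filter fun y => (σ ^ 4) y = y := by
    intro y hy
    simp only [Finset.mem_filter, Finset.mem_univ, true_and] at hy ⊢
    rw [show 4 = 2 + 2 by norm_num, pow_add, Equiv.Perm.mul_apply, hy, hy]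
  have := Finset.eq_of_subset_of_card_le hsub (by
    change fixCount _ ≤ fixCount _
    rw [h2, h4])
  have h := congrArg (fun T => y ∈ T) this
  simpa using h.symm

theorem CycleData.four_transitive (hH : CycleData H) : IsTupleTransitive H 4 := by
  obtain ⟨τ, hτ, hfix, hpow⟩ := hH.six
  obtain ⟨u, hu, hu1⟩ := exists_tuple_of_fixCount hfix
  obtain ⟨x, hx⟩ := exists_notMem_range (by norm_num) u
  refine hH.three_transitive.succ hu hx ?_
  have h := dvd_card_stabOrbit (H.pow_mem hτ 2) hu1 hx (p := 3) 1 (by norm_num)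
    (by rw [← pow_mul]; exact hpow)
  obtain ⟨σ, hσ, -, hσ2, hσ4, hσ8⟩ := hH.eight
  obtain ⟨v, hv, hv1⟩ := exists_tuple_of_fixCount hσ2
  obtain ⟨g, hg, hgu⟩ := hH.three_transitive u (fun i => v i.castSucc) hu
    (hv.comp (Fin.castSucc_injective 3))
  set σ' := g⁻¹ * σ * g with hσ'
  have hσ'H : σ' ∈ H := H.mul_mem (H.mul_mem (H.inv_mem hg) hσ) hg
  set S := stabOrbit H u x with hS
  have hσ'u : ∀ i, (σ' ^ 2) (u i) = u i := by
    intro i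
    rw [hσ', conj_pow_apply_eq_iff, hgu, hv1]
    exact ⟨_, rfl⟩
  have h4 : 4 ∣ (S.filter fun y => (σ' ^ 2) y ≠ y).card := by
    refine Equiv.Perm.four_dvd_card_of_sq_no_fixed_points (σ' ^ 2) _ ?_ ?_ ?_
    · intro y hy
      rw [Finset.mem_filter] at hy ⊢
      exact ⟨apply_mem_stabOrbit (H.pow_mem hσ'H 2) hσ'u hy.1,
        fun h => hy.2 ((σ' ^ 2).injective h)⟩
    · rw [← pow_mul]; exact conj_pow_eq_one g hσ8
    · intro y hy
      rw [Finset.mem_filter] at hy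
      rw [← pow_mul, hσ', Ne, conj_pow_apply_eq_iff, pow_four_apply_eq_iff hσ2 hσ4,
        ← conj_pow_apply_eq_iff]
      exact hy.2
  have hone : (S.filter fun y => ¬ (σ' ^ 2) y ≠ y).card ≤ 1 := by
    refine Finset.card_le_one_iff_subset_singleton.2 ⟨g⁻¹ (v (Fin.last 3)), fun y hy => ?_⟩
    rw [Finset.mem_filter, not_not, hσ', conj_pow_apply_eq_iff, hv1] at hy
    obtain ⟨hyS, i, hi⟩ := hy
    rw [Finset.mem_singleton, Equiv.Perm.eq_inv_iff_eq]
    induction i using Fin.lastCases with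
    | last => exact hi.symm
    | cast i =>
      exfalso
      rw [← hgu] at hi
      rw [← g.injective hi] at hyS
      exact notMem_stabOrbit hx i hyS
  have hsum := Finset.card_filter_add_card_filter_not (s := S) (fun y => (σ' ^ 2) y ≠ y)
  have h1 := card_stabOrbit_le (H := H) hu hx
  have h2 := card_stabOrbit_pos (H := H) (u := u) (x := x)
  rw [← hS] at h1 h2
  obtain ⟨a, ha⟩ := h
  obtain ⟨b, hb⟩ := h4
  have ha3 : a ≤ 3 := by omega
  interval_cases a <;> omega

theorem CycleData.five_transitive (hH : CycleData H)
    (hfree : ∀ u : Fin 5 → Fin 12, Injective u → ∀ g ∈ H, (∀ i, g (u i) = u i) → g = 1) :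
    IsTupleTransitive H 5 := by
  obtain ⟨τ, hτ, hfix, hpow⟩ := hH.six
  obtain ⟨v, hv, hv1⟩ := exists_tuple_of_fixCount hfix
  obtain ⟨y, hy⟩ := exists_notMem_range (by norm_num) v
  set w := τ ^ 2 with hw
  have hwH : w ∈ H := H.pow_mem hτ 2
  have hw3 : w ^ 3 = 1 := by rw [hw, ← pow_mul]; exact hpow
  have hwww : ∀ z, w (w (w z)) = z := by
    intro z
    have := congrArg (fun f => f z) hw3
    simpa [pow_succ] using this
  have hvw : ∀ i, w (v i) = v i := fun i => (hv1 _).2 ⟨i, rfl⟩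
  have hy1 : w y ≠ y := fun h => hy ((hv1 y).1 h)
  have hy2 : w (w y) ≠ w y := fun h => hy1 (w.injective h)
  have hy3 : w (w y) ≠ y := fun h => hy1 (by have h' := hwww y; rwa [h] at h')
  have hyv : ∀ i, y ≠ v i := fun i h => hy ⟨i, h.symm⟩
  have hyv1 : ∀ i, w y ≠ v i := fun i h => hyv i (w.injective (h.trans (hvw i).symm))
  have hyv2 : ∀ i, w (w y) ≠ v i := fun i h => hyv1 i (w.injective (h.trans (hvw i).symm))
  set u : Fin 4 → Fin 12 := ![y, w y, w (w y), v 0] with hu'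
  have hu : Injective u := by
    intro i j hij
    fin_cases i <;> fin_cases j <;>
      first
      | rfl
      | exact absurd hij hy1
      | exact absurd hij.symm hy1
      | exact absurd hij hy2
      | exact absurd hij.symm hy2
      | exact absurd hij hy3
      | exact absurd hij.symm hy3
      | exact absurd hij (hyv 0)
      | exact absurd hij.symm (hyv 0)
      | exact absurd hij (hyv1 0)
      | exact absurd hij.symm (hyv1 0)
      | exact absurd hij (hyv2 0)
      | exact absurd hij.symm (hyv2 0)
  have hb : v 1 ∉ Set.range u := by
    rintro ⟨i, hi⟩
    have h01 : v 0 ≠ v 1 := fun h => absurd (hv h) (by decide)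
    fin_cases i
    · exact hyv 1 hi
    · exact hyv1 1 hi
    · exact hyv2 1 hi
    · exact h01 hi
  refine hH.four_transitive.succ hu hb ?_
  obtain ⟨σ, hσ, -, hσ2, hσ4, hσ8⟩ := hH.eight
  obtain ⟨g, hg, hgu⟩ := hH.four_transitive.exists_conj_fixing hu hσ2
  set c := (g⁻¹ * σ * g) ^ 2 with hc
  have hcH : c ∈ H := H.pow_mem (H.mul_mem (H.mul_mem (H.inv_mem hg) hσ) hg) 2
  have hcu : ∀ i, c (u i) = u i := fun i => (hgu _).2 ⟨i, rfl⟩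
  have hc4 : c ^ 4 = 1 := by rw [hc, ← pow_mul]; exact conj_pow_eq_one g hσ8
  have hc2 : ∀ z, (c ^ 2) z = z ↔ ∃ i, u i = z := by
    intro z
    rw [hc, ← pow_mul, conj_pow_apply_eq_iff, pow_four_apply_eq_iff hσ2 hσ4,
      ← conj_pow_apply_eq_iff, hgu]
  set S := stabOrbit H u (v 1) with hS
  have h4 : 4 ∣ S.card := by
    refine Equiv.Perm.four_dvd_card_of_sq_no_fixed_points c S ?_ hc4 ?_
    · exact fun z hz => apply_mem_stabOrbit hcH hcu hz
    · intro z hz h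
      obtain ⟨i, rfl⟩ := (hc2 z).1 h
      exact notMem_stabOrbit hb i hz
  have hle := card_stabOrbit_le (H := H) hu hb
  have hpos := card_stabOrbit_pos (H := H) (u := u) (x := v 1)
  rw [← hS] at hle hpos
  by_contra hne
  have hS4 : S.card = 4 := by omega
  have hwu : ∀ f : Equiv.Perm (Fin 12), (∀ i, f (u i) = u i) →
      ∀ i, (w * f * w⁻¹) (u i) = u i := by
    intro f hf i
    have h0 := hf 0
    have h1 := hf 1
    have h2 := hf 2
    have h3 := hf 3
    simp only [hu', Matrix.cons_val] at h0 h1 h2 h3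
    have e0 : w⁻¹ y = w (w y) := by rw [Equiv.Perm.inv_eq_iff_eq, hwww]
    have e3 : w⁻¹ (v 0) = v 0 := by rw [Equiv.Perm.inv_eq_iff_eq, hvw]
    have e1 : w⁻¹ (w y) = y := by rw [Equiv.Perm.inv_eq_iff_eq]
    have e2 : w⁻¹ (w (w y)) = w y := by rw [Equiv.Perm.inv_eq_iff_eq]
    simp only [Equiv.Perm.mul_apply]
    fin_cases i
    · change w (f (w⁻¹ y)) = y
      rw [e0, h2, hwww]
    · change w (f (w⁻¹ (w y))) = w y
      rw [e1, h0]
    · change w (f (w⁻¹ (w (w y)))) = w (w y)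
      rw [e2, h1]
    · change w (f (w⁻¹ (v 0))) = v 0
      rw [e3, h3, hvw]
  have hwS : ∀ z ∈ S, w z ∈ S := by
    intro z hz
    obtain ⟨f, hf, hfu, rfl⟩ := mem_stabOrbit.1 hz
    refine mem_stabOrbit.2 ⟨w * f * w⁻¹, H.mul_mem (H.mul_mem hwH hf) (H.inv_mem hwH),
      hwu f hfu, ?_⟩
    have e1 : w⁻¹ (v 1) = v 1 := by rw [Equiv.Perm.inv_eq_iff_eq, hvw]
    simp only [Equiv.Perm.mul_apply, e1]
  have hbS : v 1 ∈ S := self_mem_stabOrbit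
  have h3 : 3 ∣ (S.filter fun z => w z ≠ z).card := by
    refine Equiv.Perm.prime_dvd_card_of_no_fixed_points w _ ?_ 3 1 (by norm_num)
      (by simpa using hw3) (by simp)
    intro z hz
    rw [Finset.mem_filter] at hz ⊢
    exact ⟨hwS z hz.1, fun h => hz.2 (w.injective h)⟩
  have hsum := Finset.card_filter_add_card_filter_not (s := S) (fun z => w z ≠ z)
  have hfixle : (S.filter fun z => ¬ w z ≠ z) ⊆ {v 1, v 2} := by
    intro z hz
    rw [Finset.mem_filter, not_not, hv1] at hz
    obtain ⟨hzS, i, rfl⟩ := hz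
    fin_cases i
    · exact absurd hzS (notMem_stabOrbit hb 3)
    · simp
    · simp
  have hfixpos : v 1 ∈ S.filter fun z => ¬ w z ≠ z :=
    Finset.mem_filter.2 ⟨hbS, not_not.2 (hvw 1)⟩
  have hfix2 := (Finset.card_le_card hfixle).trans Finset.card_le_two
  have hfix1 := Finset.card_pos.2 ⟨_, hfixpos⟩
  have hone : (S.filter fun z => ¬ w z ≠ z).card = 1 := by omega
  have huniq : ∀ z ∈ S, w z = z → z = v 1 := by
    intro z hz h
    obtain ⟨t, ht⟩ := Finset.card_eq_one.1 hone
    have e1 : v 1 ∈ ({t} : Finset (Fin 12)) := ht ▸ hfixpos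
    have e2 : z ∈ ({t} : Finset (Fin 12)) := ht ▸ Finset.mem_filter.2 ⟨hz, not_not.2 h⟩
    rw [Finset.mem_singleton] at e1 e2
    rw [e1, e2]
  have hcS : ∀ z ∈ S, c z ∈ S := fun z hz => apply_mem_stabOrbit hcH hcu hz
  have hcne : ∀ z ∈ S, c (c z) ≠ z := by
    intro z hz h
    obtain ⟨i, rfl⟩ := (hc2 z).1 (by simpa [pow_two] using h)
    exact notMem_stabOrbit hb i hz
  have hcne1 : ∀ z ∈ S, c z ≠ z := fun z hz h => hcne z hz (by rw [h, h])
  have hcccc : ∀ z, c (c (c (c z))) = z := by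
    intro z
    have := congrArg (fun f => f z) hc4
    simpa [pow_succ] using this
  have hb1 := hcS _ hbS
  have hb2 := hcS _ hb1
  have hb3 := hcS _ hb2
  have hSeq : ({v 1, c (v 1), c (c (v 1)), c (c (c (v 1)))} : Finset (Fin 12)) = S := by
    refine Finset.eq_of_subset_of_card_le ?_ ?_
    · intro z hz
      simp only [Finset.mem_insert, Finset.mem_singleton] at hz
      rcases hz with rfl | rfl | rfl | rfl <;> assumption
    · rw [hS4, Finset.card_insert_of_notMem, Finset.card_insert_of_notMem,
        Finset.card_insert_of_notMem, Finset.card_singleton]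
      · simpa using (hcne1 _ hbS).symm
      · simpa using ⟨(hcne1 _ hbS).symm, (hcne _ hbS).symm⟩
      · have e3 : v 1 ≠ c (c (c (v 1))) := fun h => hcne1 _ hb3 (by rw [hcccc]; exact h)
        simpa using ⟨(hcne1 _ hbS).symm, (hcne _ hbS).symm, e3⟩
  have hkey : w (c (c (v 1))) = c (v 1) ∨ w (c (c (v 1))) = c (c (c (v 1))) := by
    have h := hwS _ hb2
    rw [← hSeq] at h
    simp only [Finset.mem_insert, Finset.mem_singleton] at h
    rcases h with h | h | h | h
    · exact absurd (w.injective (h.trans (hvw 1).symm)) (hcne _ hbS)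
    · exact Or.inl h
    · exact absurd (huniq _ hb2 h) (hcne _ hbS)
    · exact Or.inr h
  have hrigid : ∀ d ∈ H, (∀ i, d (u i) = u i) → d (v 1) = v 1 → d = 1 := by
    intro d hd hdu hd1
    refine hfree (Fin.snoc (α := fun _ => Fin 12) u (v 1)) ?_ d hd ?_
    · exact Fin.snoc_injective_iff.2 ⟨hu, hb⟩
    · intro i
      induction i using Fin.lastCases with
      | last => rw [Fin.snoc_last]; exact hd1
      | cast i => rw [Fin.snoc_castSucc]; exact hdu i
  set m := w * c ^ 2 * w⁻¹ with hm
  have hmH : m ∈ H := H.mul_mem (H.mul_mem hwH (H.pow_mem hcH 2)) (H.inv_mem hwH)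
  have hmu : ∀ i, m (u i) = u i := hwu _ fun i => (hc2 _).2 ⟨i, rfl⟩
  have hm1 : m (v 1) = w (c (c (v 1))) := by
    have e1 : w⁻¹ (v 1) = v 1 := by rw [Equiv.Perm.inv_eq_iff_eq, hvw]
    simp only [hm, pow_two, Equiv.Perm.mul_apply, e1]
  have hm2 : m ^ 2 = 1 := by
    rw [hm, conj_pow, ← pow_mul, hc4]; simp
  have hcinvu : ∀ i, c⁻¹ (u i) = u i := fun i => by rw [Equiv.Perm.inv_eq_iff_eq, hcu]
  have hmc : m ^ 2 = c ^ 2 := by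
    rcases hkey with h | h
    · have : c⁻¹ * m = 1 := hrigid _ (H.mul_mem (H.inv_mem hcH) hmH)
        (fun i => by simp only [Equiv.Perm.mul_apply, hmu, hcinvu])
        (by rw [Equiv.Perm.mul_apply, hm1, h, Equiv.Perm.inv_eq_iff_eq])
      rw [inv_mul_eq_one] at this
      rw [this]
    · have : c * m = 1 := hrigid _ (H.mul_mem hcH hmH)
        (fun i => by simp [hmu, hcu]) (by rw [Equiv.Perm.mul_apply, hm1, h, hcccc])
      rw [← eq_inv_iff_mul_eq_one] at this
      have h2 : m ^ 2 * c ^ 2 = 1 := by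
        have hmc' : m = c⁻¹ := by rw [this]; simp
        rw [hmc']; simp
      have : m ^ 2 = (c ^ 2)⁻¹ := eq_inv_of_mul_eq_one_left h2
      rw [this, inv_eq_iff_mul_eq_one, ← pow_add, hc4]
  exact hcne _ hbS (by
    have := congrArg (fun f => f (v 1)) (hmc.symm.trans hm2)
    simpa [pow_two] using this)

end MultipleTransitivity

section HadamardMatrix

/-- A normalized Hadamard matrix of order twelve. -/
def hadamard (i j : Fin 12) : ℤ :=
  (([[1, 1, 1, 1, 1, 1, 1, 1, 1, 1, 1, 1],
  [1, 1, 1, -1, 1, 1, -1, 1, -1, -1, -1, -1],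
  [1, 1, -1, -1, 1, -1, -1, -1, 1, -1, 1, 1],
  [1, -1, 1, -1, -1, 1, -1, -1, -1, 1, 1, 1],
  [1, 1, -1, 1, -1, -1, -1, 1, -1, 1, -1, 1],
  [1, -1, -1, 1, 1, 1, 1, -1, -1, -1, -1, 1],
  [1, -1, 1, -1, -1, -1, 1, 1, 1, -1, -1, 1],
  [1, 1, 1, 1, -1, -1, 1, -1, -1, -1, 1, -1],
  [1, -1, -1, 1, -1, 1, -1, 1, 1, -1, 1, -1],
  [1, -1, 1, 1, 1, -1, -1, -1, 1, 1, -1, -1],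
  [1, -1, -1, -1, 1, -1, 1, 1, -1, 1, 1, -1],
  [1, 1, -1, -1, -1, 1, 1, -1, 1, 1, -1, -1]] : List (List ℤ)).getD i []).getD j 0

/-- The two columns of `hadamard` that agree on the rows `1`, `2`, `3` and `e`, for `4 ≤ e`. -/
def twinColumns (e : Fin 12) : Fin 12 × Fin 12 :=
  ([(0, 0), (0, 0), (0, 0), (0, 0), (2, 5), (3, 6), (1, 4), (3, 6), (1, 4), (10, 11), (2, 5),
    (10, 11)] : List (Fin 12 × Fin 12)).getD e (0, 0)

theorem hadamard_sq (i j : Fin 12) : hadamard i j * hadamard i j = 1 := by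
  revert i j; decide +kernel

theorem hadamard_zero_left (j : Fin 12) : hadamard 0 j = 1 := by
  revert j; decide +kernel

theorem hadamard_zero_right (i : Fin 12) : hadamard i 0 = 1 := by
  revert i; decide +kernel

theorem hadamard_triple_sum_ne_zero : ∀ a b c : Fin 12, a ≠ 0 → b ≠ 0 → c ≠ 0 → a ≠ b → a ≠ c →
    b ≠ c → ∑ j, hadamard a j * hadamard b j * hadamard c j ≠ 0 := by
  decide +kernel

theorem eq_or_mem_twinColumns : ∀ e : Fin 12, 4 ≤ e → ∀ j l : Fin 12,
    hadamard 1 j = hadamard 1 l → hadamard 2 j = hadamard 2 l → hadamard 3 j = hadamard 3 l →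
    hadamard e j = hadamard e l → j = l ∨ l = (twinColumns e).1 ∨ l = (twinColumns e).2 := by
  decide +kernel

theorem exists_hadamard_mul_ne : ∀ e i k : Fin 12, i ≠ k → ∃ j l : Fin 12,
    (j ≠ (twinColumns e).1 ∧ j ≠ (twinColumns e).2) ∧
    (l ≠ (twinColumns e).1 ∧ l ≠ (twinColumns e).2) ∧
    hadamard k j * hadamard i j ≠ hadamard k l * hadamard i l := by
  decide +kernel

theorem exists_ne_twinColumns (e : Fin 12) :
    ∃ l, l ≠ (twinColumns e).1 ∧ l ≠ (twinColumns e).2 := by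
  revert e; decide +kernel

theorem hadamard_columns_injective : ∀ j l : Fin 12, (∀ i, hadamard i j = hadamard i l) → j = l :=
    by
  decide +kernel

variable {G : Type*} [Group G] (π ρ : G →* Equiv.Perm (Fin 12))

/-- The group acts on rows and columns through automorphisms of the Hadamard matrix (up to
rescaling of rows and columns). -/
def PreservesCrossRatios : Prop := ∀ g i k j l,
  hadamard (π g i) (ρ g j) * hadamard (π g k) (ρ g l) *
      (hadamard (π g i) (ρ g l) * hadamard (π g k) (ρ g j)) =
    hadamard i j * hadamard k l * (hadamard i l * hadamard k j)

variable {π ρ}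

theorem eq_one_of_fixes_rows (hH : PreservesCrossRatios π ρ)
    (hinj : ∀ g, π g = 1 → ρ g = 1 → g = 1) (g : G) (e : Fin 12) (he : 4 ≤ e) (h0 : π g 0 = 0)
    (h1 : π g 1 = 1) (h2 : π g 2 = 2) (h3 : π g 3 = 3) (h4 : π g e = e) : g = 1 := by
  have hrow : ∀ i j l, hadamard (π g i) (ρ g j) * hadamard (π g i) (ρ g l) =
      hadamard i j * hadamard i l := by
    intro i j l
    have := hH g i 0 j l
    rw [h0] at this
    rwa [hadamard_zero_left (ρ g l), hadamard_zero_left (ρ g j), hadamard_zero_left l,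
      hadamard_zero_left j, mul_one, mul_one, mul_one, mul_one] at this
  have hδ : ∀ i, π g i = i → ∀ j, hadamard i (ρ g j) = hadamard i (ρ g 0) * hadamard i j := by
    intro i hi j
    have h := hrow i j 0
    rw [hi, hadamard_zero_right, mul_one] at h
    rw [← h, mul_comm, mul_assoc, hadamard_sq, mul_one]
  have htriple : ∀ a b c : Fin 12, π g a = a → π g b = b → π g c = c → a ≠ 0 → b ≠ 0 → c ≠ 0 →
      a ≠ b → a ≠ c → b ≠ c →
      hadamard a (ρ g 0) * hadamard b (ρ g 0) * hadamard c (ρ g 0) = 1 := by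
    intro a b c ha hb hc ha0 hb0 hc0 hab hac hbc
    have hne := hadamard_triple_sum_ne_zero a b c ha0 hb0 hc0 hab hac hbc
    have hsum := Equiv.sum_comp (ρ g) fun j => hadamard a j * hadamard b j * hadamard c j
    have h : ∀ j, hadamard a (ρ g j) * hadamard b (ρ g j) * hadamard c (ρ g j) =
        hadamard a (ρ g 0) * hadamard b (ρ g 0) * hadamard c (ρ g 0) *
          (hadamard a j * hadamard b j * hadamard c j) := by
      intro j
      rw [hδ a ha, hδ b hb, hδ c hc]
      ring
    rw [Finset.sum_congr rfl fun j _ => h j, ← Finset.mul_sum] at hsum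
    exact mul_right_cancel₀ hne (hsum.trans (one_mul _).symm)
  have e0 : e ≠ 0 := by rintro rfl; exact absurd he (by decide)
  have e1 : e ≠ 1 := by rintro rfl; exact absurd he (by decide)
  have e2 : e ≠ 2 := by rintro rfl; exact absurd he (by decide)
  have e3 : e ≠ 3 := by rintro rfl; exact absurd he (by decide)
  have t123 := htriple 1 2 3 h1 h2 h3 (by decide) (by decide) (by decide) (by decide) (by decide)
    (by decide)
  have t12e := htriple 1 2 e h1 h2 h4 (by decide) (by decide) e0 (by decide) e1.symm e2.symm
  have t13e := htriple 1 3 e h1 h3 h4 (by decide) (by decide) e0 (by decide) e1.symm e3.symm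
  have t23e := htriple 2 3 e h2 h3 h4 (by decide) (by decide) e0 (by decide) e2.symm e3.symm
  have s := fun i => mul_self_eq_one_iff.1 (hadamard_sq i (ρ g 0))
  have hone : hadamard 1 (ρ g 0) = 1 ∧ hadamard 2 (ρ g 0) = 1 ∧ hadamard 3 (ρ g 0) = 1 ∧
      hadamard e (ρ g 0) = 1 := by
    rcases s 1 with q1 | q1 <;> rcases s 2 with q2 | q2 <;> rcases s 3 with q3 | q3 <;>
      rcases s e with q4 | q4 <;> rw [q1, q2, q3] at t123 <;> rw [q1, q2, q4] at t12e <;>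
      rw [q1, q3, q4] at t13e <;> rw [q2, q3, q4] at t23e <;>
      first
      | exact ⟨q1, q2, q3, q4⟩
      | omega
  obtain ⟨q1, q2, q3, q4⟩ := hone
  have hfix : ∀ l, l ≠ (twinColumns e).1 ∧ l ≠ (twinColumns e).2 → ρ g l = l := by
    intro l hl
    have := eq_or_mem_twinColumns e he (ρ g l) l (by rw [hδ 1 h1, q1, one_mul])
      (by rw [hδ 2 h2, q2, one_mul]) (by rw [hδ 3 h3, q3, one_mul]) (by rw [hδ e h4, q4, one_mul])
    tauto
  have hπ : π g = 1 := by
    ext1 i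
    by_contra hi
    obtain ⟨j, l, hj, hl, hne⟩ := exists_hadamard_mul_ne e i (π g i) (Ne.symm hi)
    have h := hrow i j l
    rw [hfix j hj, hfix l hl] at h
    apply hne
    calc hadamard (π g i) j * hadamard i j
        = hadamard (π g i) j * (hadamard (π g i) l * hadamard (π g i) l) * hadamard i j := by
          rw [hadamard_sq, mul_one]
      _ = hadamard (π g i) l * (hadamard (π g i) j * hadamard (π g i) l) * hadamard i j := by ring
      _ = hadamard (π g i) l * hadamard i l * (hadamard i j * hadamard i j) := by rw [h]; ring
      _ = _ := by rw [hadamard_sq, mul_one]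
  refine hinj g hπ ?_
  obtain ⟨l, hl⟩ := exists_ne_twinColumns e
  ext1 j
  refine hadamard_columns_injective _ _ fun i => ?_
  have h := hrow i j l
  rw [hπ, Equiv.Perm.one_apply, hfix l hl] at h
  have h' := congrArg (· * hadamard i l) h
  simpa [mul_assoc, hadamard_sq] using h'

theorem card_eq_of_cycleData (hH : PreservesCrossRatios π ρ)
    (hinj : ∀ g, π g = 1 → ρ g = 1 → g = 1) (hcyc : CycleData π.range) : Nat.card G = 95040 := by
  have hfree : ∀ u : Fin 5 → Fin 12, Function.Injective u → ∀ g : G, (∀ i, π g (u i) = u i) →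
      g = 1 := by
    intro u hu g hgu
    have hv : Function.Injective (![0, 1, 2, 3] : Fin 4 → Fin 12) := by decide
    obtain ⟨_, ⟨s, rfl⟩, hs⟩ := hcyc.four_transitive (fun i => u i.castSucc) _
      (hu.comp (Fin.castSucc_injective 4)) hv
    have key : ∀ i, π (s * g * s⁻¹) (π s (u i)) = π s (u i) := by
      intro i
      simp only [← Equiv.Perm.mul_apply, ← map_mul]
      rw [inv_mul_cancel_right, map_mul, Equiv.Perm.mul_apply, hgu]
    have h0 : π s (u 0) = 0 := hs 0
    have h1 : π s (u 1) = 1 := hs 1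
    have h2 : π s (u 2) = 2 := hs 2
    have h3 : π s (u 3) = 3 := hs 3
    have n0 : π s (u 4) ≠ 0 := fun h => absurd (hu ((π s).injective (h.trans h0.symm))) (by decide)
    have n1 : π s (u 4) ≠ 1 := fun h => absurd (hu ((π s).injective (h.trans h1.symm))) (by decide)
    have n2 : π s (u 4) ≠ 2 := fun h => absurd (hu ((π s).injective (h.trans h2.symm))) (by decide)
    have n3 : π s (u 4) ≠ 3 := fun h => absurd (hu ((π s).injective (h.trans h3.symm))) (by decide)
    have h4 : 4 ≤ π s (u 4) := by
      revert n0 n1 n2 n3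
      generalize π s (u 4) = x
      revert x
      decide
    have := eq_one_of_fixes_rows hH hinj (s * g * s⁻¹) (π s (u 4)) h4 (by simpa [h0] using key 0)
      (by rw [← h1]; exact key 1) (by rw [← h2]; exact key 2) (by rw [← h3]; exact key 3) (key 4)
    rwa [mul_inv_eq_one, mul_eq_left] at this
  have h5 : IsTupleTransitive π.range 5 := by
    refine hcyc.five_transitive ?_
    rintro u hu _ ⟨g, rfl⟩ hgu
    rw [hfree u hu g hgu, map_one]
  let u0 : Fin 5 ↪ Fin 12 := Fin.castLEEmb (by norm_num)
  let F : G → (Fin 5 ↪ Fin 12) := fun g => u0.trans (π g).toEmbedding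
  have hF : Function.Bijective F := by
    constructor
    · intro g s hgs
      have h : ∀ i, π g (u0 i) = π s (u0 i) := fun i => DFunLike.congr_fun hgs i
      have := hfree u0 u0.injective (s⁻¹ * g) (fun i => by
        rw [map_mul, Equiv.Perm.mul_apply, h, ← Equiv.Perm.mul_apply, ← map_mul]; simp)
      exact (inv_mul_eq_one.1 this).symm
    · intro v
      obtain ⟨_, ⟨s, rfl⟩, hs⟩ := h5 u0 v u0.injective v.injective
      exact ⟨s, by ext1 i; exact hs i⟩
  rw [Nat.card_congr (Equiv.ofBijective F hF), Nat.card_eq_fintype_card,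
    Fintype.card_embedding_eq]
  simp [Nat.descFactorial]

end HadamardMatrix

section Frobenius

attribute [local instance] Ideal.Quotient.field in
theorem exists_reduction_and_frobenius {A B G : Type} [CommRing A] [CommRing B] [Algebra A B]
    [Group G] [Finite G] [MulSemiringAction G B] [SMulCommClass G A B] [Algebra.IsInvariant A B G]
    [Module.Finite A B] [FaithfulSMul A B] (p : ℕ) [Fact p.Prime] (ψ : A →+* ZMod p) :
    ∃ (k : Type) (_ : Field k) (_ : CharP k p) (φ : B →+* k),
      (∀ a, φ (algebraMap A B a) = ZMod.castHom (dvd_refl p) k (ψ a)) ∧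
        ∃ g : G, ∀ b, φ (g • b) = φ b ^ p := by
  have hψ : Function.Surjective ψ := ZMod.ringHom_surjective ψ
  have hmax : (RingHom.ker ψ).IsMaximal := RingHom.ker_isMaximal_of_surjective ψ hψ
  have : Algebra.IsIntegral A B := Algebra.IsIntegral.of_finite A B
  obtain ⟨Q, hQ, hQP⟩ := Ideal.exists_ideal_over_maximal_of_isIntegral (S := B) (RingHom.ker ψ) (by
    rw [(RingHom.injective_iff_ker_eq_bot _).1 (FaithfulSMul.algebraMap_injective A B)]
    exact bot_le)
  have hunder : Q.under A = RingHom.ker ψ := hQP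
  have e : A ⧸ Q.under A ≃+* ZMod p :=
    (Ideal.quotEquivOfEq hunder).trans (RingHom.quotientKerEquivOfSurjective hψ)
  have hfinA : Finite (A ⧸ Q.under A) := Finite.of_equiv _ e.symm.toEquiv
  have hcard : Nat.card (A ⧸ Q.under A) = p := by
    rw [Nat.card_congr e.toEquiv, Nat.card_zmod]
  have hmodfin : Module.Finite (A ⧸ Q.under A) (B ⧸ Q) := by
    have : Module.Finite A (B ⧸ Q) := inferInstance
    exact Module.Finite.of_restrictScalars_finite A _ _
  have hfin : Finite (B ⧸ Q) := Module.finite_of_finite (A ⧸ Q.under A)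
  obtain ⟨g, hg⟩ := IsArithFrobAt.exists_of_isInvariant A G Q
  have hp : (p : B ⧸ Q) = 0 := by
    have h1 : (p : A) ∈ Q.under A := by rw [hunder, RingHom.mem_ker]; simp
    have h2 : algebraMap A B (p : A) ∈ Q := h1
    rw [map_natCast] at h2
    rw [← map_natCast (Ideal.Quotient.mk Q)]
    exact Ideal.Quotient.eq_zero_iff_mem.2 h2
  have hchar : CharP (B ⧸ Q) p := (CharP.charP_iff_prime_eq_zero (Fact.out)).2 hp
  refine ⟨B ⧸ Q, inferInstance, hchar, Ideal.Quotient.mk Q, fun a => ?_, g, fun b => ?_⟩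
  · obtain ⟨n, hn⟩ := ZMod.natCast_zmod_surjective (ψ a)
    have h1 : a - (n : A) ∈ Q.under A := by rw [hunder, RingHom.mem_ker]; simp [hn]
    have h2 : algebraMap A B (a - n) ∈ Q := h1
    rw [map_sub, map_natCast, ← Ideal.Quotient.eq_zero_iff_mem, map_sub, sub_eq_zero] at h2
    rw [h2, ← hn]
    simp
  · have := hg b
    rw [hcard] at this
    rw [← map_pow, ← sub_eq_zero, ← map_sub, Ideal.Quotient.eq_zero_iff_mem]
    exact this

theorem isFractionRing_int_polynomial [Algebra ℤ[X] (RatFunc ℚ)]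
    (h : algebraMap ℤ[X] (RatFunc ℚ) =
      (algebraMap ℚ[X] (RatFunc ℚ)).comp (mapRingHom (Int.castRingHom ℚ))) :
    IsFractionRing ℤ[X] (RatFunc ℚ) := by
  have hinj : Function.Injective (algebraMap ℤ[X] (RatFunc ℚ)) := by
    rw [h, RingHom.coe_comp]
    exact (RatFunc.algebraMap_injective ℚ).comp
      (Polynomial.map_injective _ (RingHom.injective_int _))
  have : FaithfulSMul ℤ[X] (RatFunc ℚ) := (faithfulSMul_iff_algebraMap_injective _ _).2 hinj
  have hclear : ∀ q : ℚ[X], ∃ (n : ℤ) (r : ℤ[X]), n ≠ 0 ∧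
      r.map (Int.castRingHom ℚ) = C (n : ℚ) * q := by
    intro q
    obtain ⟨b, hb, hb'⟩ := IsLocalization.integerNormalization_spec (nonZeroDivisors ℤ) q
    refine ⟨b, IsLocalization.integerNormalization (nonZeroDivisors ℤ) q,
      nonZeroDivisors.ne_zero hb, ?_⟩
    rw [← eq_intCast (algebraMap ℤ ℚ), ← Polynomial.smul_eq_C_mul, algebraMap_smul]
    exact hb'
  refine IsFractionRing.of_field _ _ fun z => ?_
  obtain ⟨x, y, hy, hz⟩ := IsFractionRing.div_surjective ℚ[X] z
  have hy0 : algebraMap ℚ[X] (RatFunc ℚ) y ≠ 0 := by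
    rw [Ne, FaithfulSMul.algebraMap_eq_zero_iff]; exact nonZeroDivisors.ne_zero hy
  obtain ⟨n, r, hn, hr⟩ := hclear x
  obtain ⟨m, s, hm, hs⟩ := hclear y
  refine ⟨C m * r, C n * s, ?_⟩
  have hn0 : algebraMap ℚ[X] (RatFunc ℚ) (C (n : ℚ)) ≠ 0 := by
    simpa using hn
  have hm0 : algebraMap ℚ[X] (RatFunc ℚ) (C (m : ℚ)) ≠ 0 := by
    simpa using hm
  have hC : ∀ n : ℤ, (C n : ℤ[X]).map (Int.castRingHom ℚ) = C (n : ℚ) := fun n => by simp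
  rw [← hz, h]
  simp only [RingHom.comp_apply, map_mul, coe_mapRingHom, hr, hs, hC]
  field_simp

end Frobenius

section Resolvent

variable {R S : Type} [CommRing R] [CommRing S]

/-- The quartic form `z ^ 4 + 300 z ^ 3 + ⋯` whose cube is the `t`-independent part of the
degree twelve polynomial. -/
def quartic (a z : R) : R :=
  z ^ 4 + 300 * z ^ 3 + 25 * (870 - 24 * a) * z ^ 2 + 125 * (220 - 16 * a) * z +
    625 * (648 * a - 6399)

/-- The monic degree twelve form, a rescaling of the polynomial `f_A` by `z = 5 x`. -/
def dodecic (a t z : R) : R :=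
  quartic a z ^ 3 + 2 ^ 12 * 3 ^ 15 * 5 ^ 7 * (118 * a - 475) * t * z ^ 2

/-- Numerator of the ratio attached to a root `z` and a conjugate root `w`. -/
def ratioNum (a z w : R) : R := -((2 + a) ^ 2 * z * quartic (-a) w)

/-- Denominator of the ratio attached to a root `z` and a conjugate root `w`. -/
def ratioDen (a z w : R) : R := 3 * (2 - a) ^ 2 * w * quartic a z

/-- The even part of the degree twelve relation between the square root of `n / d` and `w`. -/
def evenPart (a n d w : R) : R :=
    (118 + 95 * a) * n * d ^ 5 * w ^ 2 +
    (2124 + 1710 * a) * n ^ 2 * d ^ 4 * w ^ 2 +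
    (14904 + 5994 * a) * n ^ 3 * d ^ 3 * w ^ 2 +
    (56862 + 8748 * a) * n ^ 4 * d ^ 2 * w ^ 2 +
    (118098) * n ^ 5 * d * w ^ 2 +
    (59049) * n ^ 6 * w ^ 2 +
    (7170 - 9240 * a) * n * d ^ 5 * w +
    (17550 + 39150 * a) * n ^ 2 * d ^ 4 * w +
    (-131220 - 65610 * a) * n ^ 3 * d ^ 3 * w +
    (-18225 + 72900 * a) * d ^ 6 +
    (-454050 + 84825 * a) * n * d ^ 5

/-- The odd part of the degree twelve relation between the square root of `n / d` and `w`. -/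
def oddPart (a n d w : R) : R :=
    (-708 - 570 * a) * n * d ^ 4 * w ^ 2 +
    (-5670 - 3564 * a) * n ^ 2 * d ^ 3 * w ^ 2 +
    (-32319 - 8505 * a) * n ^ 3 * d ^ 2 * w ^ 2 +
    (-87480 - 4374 * a) * n ^ 4 * d * w ^ 2 +
    (-118098) * n ^ 5 * w ^ 2 +
    (1755 + 3915 * a) * d ^ 5 * w +
    (-42660 - 4320 * a) * n * d ^ 4 * w +
    (106920 - 34020 * a) * n ^ 2 * d ^ 3 * w +
    (47385 + 105705 * a) * n ^ 3 * d ^ 2 * w +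
    (240975 - 143775 * a) * d ^ 5

theorem evenPart_sq_sub (a n d w : R) (ha : a ^ 2 = -5) :
    evenPart a n d w ^ 2 - n * d * oddPart a n d w ^ 2 =
      (2 + a) ^ 8 * ((3 * (2 - a) ^ 2 * n ^ 3 * w) ^ 4 +
        300 * (3 * (2 - a) ^ 2 * n ^ 3 * w) ^ 3 * d ^ 3 +
        25 * (870 - 24 * a) * (3 * (2 - a) ^ 2 * n ^ 3 * w) ^ 2 * d ^ 6 +
        125 * (220 - 16 * a) * (3 * (2 - a) ^ 2 * n ^ 3 * w) * d ^ 9 +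
        625 * (648 * a - 6399) * d ^ 12 + (2 + a) ^ 2 * n ^ 2 * d ^ 10 * quartic (-a) w) := by
  simp only [evenPart, oddPart, quartic]
  linear_combination (
      ((95) * n * d ^ 5 * w ^ 2 + (1710) * n ^ 2 * d ^ 4 * w ^ 2 + (5994) * n ^ 3 * d ^ 3 * w ^ 2 +
          (8748) * n ^ 4 * d ^ 2 * w ^ 2 + (-9240) * n * d ^ 5 * w + (39150) * n ^ 2 * d ^ 4 * w +
          (-65610) * n ^ 3 * d ^ 3 * w + (72900) * d ^ 6 + (84825) * n * d ^ 5) ^ 2 -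
      n * d * ((-570) * n * d ^ 4 * w ^ 2 + (-3564) * n ^ 2 * d ^ 3 * w ^ 2 + (-8505) * n ^ 3 *
          d ^ 2 * w ^ 2 + (-4374) * n ^ 4 * d * w ^ 2 + (3915) * d ^ 5 * w + (-4320) * n * d ^ 4 *
          w + (-34020) * n ^ 2 * d ^ 3 * w + (105705) * n ^ 3 * d ^ 2 * w + (-143775) *
          d ^ 5) ^ 2 - (
      ((-696295197) + (137135673) * a ^ 2 + (-25569189) * a ^ 4 + (4184865) * a ^ 6 + (-546669) *
          a ^ 8 + (51273) * a ^ 10 + (-2997) * a ^ 12 + (81) * a ^ 14) * n ^ 12 * w ^ 4 +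
      ((887476500) + (-3417195600) * a ^ 1 + (-210672900) * a ^ 2 + (643626000) * a ^ 3 +
          (57064500) * a ^ 4 + (-103842000) * a ^ 5 + (-13486500) * a ^ 6 + (12474000) * a ^ 7 +
          (2178900) * a ^ 8 + (-939600) * a ^ 9 + (-202500) * a ^ 10 + (32400) * a ^ 11 + (8100) *
          a ^ 12) * n ^ 9 * d ^ 3 * w ^ 3 +
      ((20735982450) + (1811413800) * a ^ 1 + (-4075864650) * a ^ 2 + (-605032200) * a ^ 3 +
          (651427650) * a ^ 4 + (165796200) * a ^ 5 + (-61234650) * a ^ 6 + (-25072200) * a ^ 7 +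
          (1321650) * a ^ 8 + (1549800) * a ^ 9 + (152550) * a ^ 10 + (-5400) * a ^ 11) * n ^ 6 *
          d ^ 6 * w ^ 2 +
      ((-152839500) + (484332000) * a ^ 1 + (81793500) * a ^ 2 + (-83964000) * a ^ 3 +
          (-32371500) * a ^ 4 + (3084000) * a ^ 5 + (3853500) * a ^ 6 + (708000) * a ^ 7 +
          (10500) * a ^ 8 + (-6000) * a ^ 9) * n ^ 3 * d ^ 9 * w +
      ((5043211875) + (-266895000) * a ^ 1 + (-2359074375) * a ^ 2 + (-1234845000) * a ^ 3 +
          (-278893125) * a ^ 4 + (-20655000) * a ^ 5 + (2480625) * a ^ 6 + (405000) * a ^ 7) *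
          d ^ 12 +
      ((6445) + (-3460) * a ^ 1 + (1015) * a ^ 2 + (3764) * a ^ 3 + (2485) * a ^ 4 + (860) *
          a ^ 5 + (175) * a ^ 6 + (20) * a ^ 7 + (1) * a ^ 8) * n ^ 2 * d ^ 10 * w ^ 4 +
      ((1933500) + (-1038000) * a ^ 1 + (304500) * a ^ 2 + (1129200) * a ^ 3 + (745500) * a ^ 4 +
          (258000) * a ^ 5 + (52500) * a ^ 6 + (6000) * a ^ 7 + (300) * a ^ 8) * n ^ 2 * d ^ 10 *
          w ^ 3 +
      ((153630750) + (-71388000) * a ^ 1 + (20000250) * a ^ 2 + (82476000) * a ^ 3 + (56307150) *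
          a ^ 4 + (20196000) * a ^ 5 + (4322250) * a ^ 6 + (540000) * a ^ 7 + (33750) * a ^ 8 +
          (600) * a ^ 9) * n ^ 2 * d ^ 10 * w ^ 2 +
      ((222077500) + (-82260000) * a ^ 1 + (20992500) * a ^ 2 + (105540000) * a ^ 3 + (75865500) *
          a ^ 4 + (28620000) * a ^ 5 + (6532500) * a ^ 6 + (900000) * a ^ 7 + (67500) * a ^ 8 +
          (2000) * a ^ 9) * n ^ 2 * d ^ 10 * w +
      ((-34856071875) + (11227612500) * a ^ 1 + (-2658065625) * a ^ 2 + (-15464722500) * a ^ 3 +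
          (-11462866875) * a ^ 4 + (-4445887500) * a ^ 5 + (-1048190625) * a ^ 6 + (-150862500) *
          a ^ 7 + (-12099375) * a ^ 8 + (-405000) * a ^ 9) * n ^ 2 * d ^ 10)) * ha

theorem quartic_cube_relation {a t z w : R} (ha : a ^ 2 = -5) (hz : dodecic a t z = 0)
    (hw : dodecic (-a) t w = 0) :
    9 * (2 - a) ^ 4 * w ^ 2 * quartic a z ^ 3 + (2 + a) ^ 6 * z ^ 2 * quartic (-a) w ^ 3 = 0 := by
  unfold dodecic at hz hw
  generalize quartic a z = p at *
  generalize quartic (-a) w = q at *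
  have h1 : 118 * a - 475 = -(a * (2 + a) ^ 5) := by
    linear_combination ((-95) + (30) * a ^ 1 + (35) * a ^ 2 + (10) * a ^ 3 + (1) * a ^ 4) * ha
  have h2 : 118 * -a - 475 = a * (2 - a) ^ 5 := by
    linear_combination ((-95) + (-30) * a ^ 1 + (35) * a ^ 2 + (-10) * a ^ 3 + (1) * a ^ 4) * ha
  have h3 : (2 + a) * (2 - a) = 9 := by linear_combination -ha
  rw [h1] at hz
  rw [h2] at hw
  linear_combination 9 * (2 - a) ^ 4 * w ^ 2 * hz + (2 + a) ^ 6 * z ^ 2 * hw -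
    2 ^ 12 * 3 ^ 15 * 5 ^ 7 * a * t * z ^ 2 * w ^ 2 * (2 - a) ^ 4 * (2 + a) ^ 5 * h3

theorem evenPart_sq {a t z w : R} (ha : a ^ 2 = -5) (hz : dodecic a t z = 0)
    (hw : dodecic (-a) t w = 0) :
    evenPart a (ratioNum a z w) (ratioDen a z w) w ^ 2 =
      ratioNum a z w * ratioDen a z w *
        oddPart a (ratioNum a z w) (ratioDen a z w) w ^ 2 := by
  have h := quartic_cube_relation ha hz hw
  have h1 : 3 * (2 - a) ^ 2 * ratioNum a z w ^ 3 * w = z * ratioDen a z w ^ 3 := by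
    simp only [ratioNum, ratioDen]
    linear_combination -(3 * (2 - a) ^ 2 * z * w) * h
  have h2 : quartic a z * ratioDen a z w ^ 2 +
      (2 + a) ^ 2 * ratioNum a z w ^ 2 * quartic (-a) w = 0 := by
    simp only [ratioNum, ratioDen]
    linear_combination h
  have h3 := evenPart_sq_sub a (ratioNum a z w) (ratioDen a z w) w ha
  rw [h1] at h3
  rw [quartic] at h2
  linear_combination h3 + (2 + a) ^ 8 * ratioDen a z w ^ 10 * h2

/-- The numerator of the square root of the ratio attached to `z` and `w`. -/
def rootNum (a z w : R) : R := evenPart a (ratioNum a z w) (ratioDen a z w) w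

/-- The denominator of the square root of the ratio attached to `z` and `w`. -/
def rootDen (a z w : R) : R := ratioDen a z w * oddPart a (ratioNum a z w) (ratioDen a z w) w

theorem map_quartic (f : R →+* S) (a z : R) : f (quartic a z) = quartic (f a) (f z) := by
  simp [quartic, map_ofNat]

theorem map_dodecic (f : R →+* S) (a t z : R) :
    f (dodecic a t z) = dodecic (f a) (f t) (f z) := by
  simp [dodecic, map_quartic, map_ofNat]

theorem map_rootNum (f : R →+* S) (a z w : R) :
    f (rootNum a z w) = rootNum (f a) (f z) (f w) := by
  simp [rootNum, evenPart, ratioNum, ratioDen, map_quartic, map_ofNat]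

theorem map_rootDen (f : R →+* S) (a z w : R) :
    f (rootDen a z w) = rootDen (f a) (f z) (f w) := by
  simp [rootDen, oddPart, ratioNum, ratioDen, map_quartic, map_ofNat]

theorem cross_sq_eq {a t z z' w w' : R} (ha : a ^ 2 = -5) (hz : dodecic a t z = 0)
    (hz' : dodecic a t z' = 0) (hw : dodecic (-a) t w = 0) (hw' : dodecic (-a) t w' = 0) :
    (rootNum a z w * rootNum a z' w' * (rootDen a z w' * rootDen a z' w)) ^ 2 =
      (rootNum a z w' * rootNum a z' w * (rootDen a z w * rootDen a z' w')) ^ 2 := by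
  have h1 := evenPart_sq ha hz hw
  have h2 := evenPart_sq ha hz' hw'
  have h3 := evenPart_sq ha hz hw'
  have h4 := evenPart_sq ha hz' hw
  simp only [mul_pow, rootNum, rootDen]
  rw [h1, h2, h3, h4]
  generalize oddPart a _ _ _ = o1
  generalize oddPart a _ _ _ = o2
  generalize oddPart a _ _ _ = o3
  generalize oddPart a _ _ _ = o4
  simp only [ratioNum, ratioDen]
  ring

/-- The roots modulo `3121` of the degree twelve form with `a = 256`, `t = 447`. -/
def splitRoots (i : Fin 12) : ℤ :=
  ([371, 717, 1021, 1059, 1100, 1329, 1331, 1490, 1828, 2129, 2524, 2927] : List ℤ).getD i 0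

/-- The roots modulo `3121` of the degree twelve form with `a = -256`, `t = 447`. -/
def splitConjRoots (j : Fin 12) : ℤ :=
  ([97, 253, 919, 1056, 1361, 1700, 2057, 2441, 2651, 2755, 2818, 2839] : List ℤ).getD j 0

/-- Row factors of the matrix of square roots modulo `3121`. -/
def splitRowFactors (i : Fin 12) : ℤ :=
  ([1267, 1327, 151, 1471, 1980, 2354, 1475, 1994, 1478, 378, 3099, 1750] : List ℤ).getD i 0

/-- Column factors of the matrix of square roots modulo `3121`. -/
def splitColFactors (j : Fin 12) : ℤ :=
  ([1, 2775, 579, 526, 2307, 668, 1004, 200, 375, 803, 414, 1537] : List ℤ).getD j 0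

theorem split_rootNum : ∀ i j : Fin 12,
    (rootNum 256 (splitRoots i) (splitConjRoots j) -
      hadamard i j * (splitRowFactors i * splitColFactors j) *
        rootDen 256 (splitRoots i) (splitConjRoots j)) % 3121 = 0 := by
  decide +kernel

theorem split_rootDen : ∀ i j : Fin 12,
    (splitRowFactors i * splitColFactors j *
      rootDen 256 (splitRoots i) (splitConjRoots j)) % 3121 ≠ 0 := by
  decide +kernel

end Resolvent

section ListArithmetic

variable {k : Type} [Field k]

/-- The value at `x` of the polynomial with the given coefficients, constant term first. -/
def evalList (x : k) : List ℕ → k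
  | [] => 0
  | c :: l => c + x * evalList x l

/-- The coefficients modulo `p` of `u + c v`. -/
def addSmul (p c : ℕ) : List ℕ → List ℕ → List ℕ
  | [], [] => []
  | a :: u, [] => a :: u
  | [], b :: v => (c * b) % p :: addSmul p c [] v
  | a :: u, b :: v => (a + c * b) % p :: addSmul p c u v

/-- Application to a list whose entries are evaluated first, for use in kernel computations. -/
def applyEvaluated {α : Type} : List ℕ → (List ℕ → α) → α
  | [], f => f []
  | c :: l, f =>
    Nat.rec (applyEvaluated l fun l' => f (0 :: l'))
      (fun c' _ => applyEvaluated l fun l' => f ((c' + 1) :: l')) c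

theorem applyEvaluated_eq {α : Type} (l : List ℕ) (f : List ℕ → α) :
    applyEvaluated l f = f l := by
  induction l generalizing f with
  | nil => rfl
  | cons c l ih => cases c <;> exact ih _

/-- Multiplication by `X` modulo `p` and `X ^ n - r`, with `n` the length of `r`. -/
def mulXMod (p : ℕ) (r u : List ℕ) : List ℕ :=
  if u.length = r.length then addSmul p (u.getLastD 0) (0 :: u).dropLast r else 0 :: u

/-- Multiplication modulo `p` and `X ^ n - r`, with `n` the length of `r`. -/
def mulMod (p : ℕ) (r : List ℕ) : List ℕ → List ℕ → List ℕ
  | [], _ => []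
  | c :: u, v => applyEvaluated (mulMod p r u v) fun w =>
    applyEvaluated (mulXMod p r w) fun w' => addSmul p c w' v

/-- Powers modulo `p` and `X ^ n - r`, with `n` the length of `r`. -/
def powMod (p : ℕ) (r u : List ℕ) : ℕ → List ℕ
  | 0 => [1]
  | e + 1 => applyEvaluated (powMod p r u e) (mulMod p r u)

/-- The remainder of `X ^ (p ^ m)` modulo `p` and `X ^ n - r`, with `n` the length of `r`. -/
def frobMod (p : ℕ) (r : List ℕ) : ℕ → List ℕ
  | 0 => mulXMod p r [1]
  | m + 1 => applyEvaluated (frobMod p r m) fun u => powMod p r u p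

/-- The remainder of `X ^ (p ^ m) - X` modulo `p` and `X ^ n - r`. -/
def frobSubMod (p : ℕ) (r : List ℕ) (m : ℕ) : List ℕ :=
  addSmul p (p - 1) (frobMod p r m) (mulXMod p r [1])

/-- All coefficients vanish. -/
def allZero (l : List ℕ) : Bool := l.all fun c => c == 0

/-- The polynomials `u` and `v` are inverse to each other modulo `p` and `X ^ n - r`. -/
def inverseMod (p : ℕ) (r u v : List ℕ) : Bool :=
  allZero (addSmul p (p - 1) (mulMod p r v u) [1])

theorem evalList_append (x : k) (u v : List ℕ) :
    evalList x (u ++ v) = evalList x u + x ^ u.length * evalList x v := by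
  induction u with
  | nil => simp [evalList]
  | cons a u ih => simp only [List.cons_append, evalList, ih, List.length_cons]; ring

theorem evalList_addSmul (p : ℕ) [CharP k p] (x : k) (c : ℕ) (u v : List ℕ) :
    evalList x (addSmul p c u v) = evalList x u + c * evalList x v := by
  induction u generalizing v with
  | nil =>
    induction v with
    | nil => simp [addSmul, evalList]
    | cons b v ih =>
      simp only [addSmul, evalList, ih, ← CharP.cast_eq_mod k p, Nat.cast_mul]
      ring
  | cons a u ih =>
    cases v with
    | nil => simp [addSmul, evalList]
    | cons b v =>
      simp only [addSmul, evalList, ih, ← CharP.cast_eq_mod k p, Nat.cast_mul, Nat.cast_add]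
      ring

theorem evalList_eq_zero (x : k) (l : List ℕ) (h : allZero l = true) : evalList x l = 0 := by
  induction l with
  | nil => rfl
  | cons a l ih =>
    simp only [allZero, List.all_cons, Bool.and_eq_true, beq_iff_eq] at h ih
    simp [evalList, h.1, ih h.2]

variable {p : ℕ} [CharP k p] {x : k} {r : List ℕ}

theorem evalList_mulXMod (hr : x ^ r.length = evalList x r) (u : List ℕ) :
    evalList x (mulXMod p r u) = x * evalList x u := by
  unfold mulXMod
  split_ifs with h
  · rw [evalList_addSmul, ← hr, ← h]
    rcases List.eq_nil_or_concat u with rfl | ⟨v, b, rfl⟩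
    · simp [evalList]
    · have : (0 :: (v ++ [b])).dropLast = 0 :: v := by
        rw [← List.cons_append, List.dropLast_concat]
      simp only [List.concat_eq_append, this, evalList, evalList_append, List.getLastD_concat,
        List.length_append, List.length_cons, List.length_nil]
      push_cast
      ring
  · simp [evalList]

theorem evalList_mulMod (hr : x ^ r.length = evalList x r) (u v : List ℕ) :
    evalList x (mulMod p r u v) = evalList x u * evalList x v := by
  induction u with
  | nil => simp [mulMod, evalList]
  | cons c u ih =>
    rw [mulMod, applyEvaluated_eq, applyEvaluated_eq, evalList_addSmul, evalList_mulXMod hr, ih,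
        evalList]
    ring

theorem evalList_powMod (hr : x ^ r.length = evalList x r) (u : List ℕ) (e : ℕ) :
    evalList x (powMod p r u e) = evalList x u ^ e := by
  induction e with
  | zero => simp [powMod, evalList]
  | succ e ih => rw [powMod, applyEvaluated_eq, evalList_mulMod hr, ih, pow_succ']

theorem evalList_frobMod (hr : x ^ r.length = evalList x r) (m : ℕ) :
    evalList x (frobMod p r m) = x ^ p ^ m := by
  induction m with
  | zero => simp [frobMod, evalList_mulXMod hr, evalList]
  | succ m ih => rw [frobMod, applyEvaluated_eq, evalList_powMod hr, ih, ← pow_mul, ← pow_succ]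

theorem natCast_pred_eq_neg_one [Fact p.Prime] : ((p - 1 : ℕ) : k) = -1 := by
  rw [Nat.cast_sub (Nat.Prime.one_le Fact.out), CharP.cast_eq_zero]
  simp

theorem evalList_frobSubMod [Fact p.Prime] (hr : x ^ r.length = evalList x r) (m : ℕ) :
    evalList x (frobSubMod p r m) = x ^ p ^ m - x := by
  rw [frobSubMod, evalList_addSmul, evalList_frobMod hr, natCast_pred_eq_neg_one,
    evalList_mulXMod hr]
  simp [evalList]
  ring

theorem evalList_ne_zero_of_inverseMod [Fact p.Prime] (hr : x ^ r.length = evalList x r)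
    {u v : List ℕ} (h : inverseMod p r u v = true) : evalList x v ≠ 0 := by
  intro h0
  have := evalList_eq_zero x _ h
  rw [evalList_addSmul, evalList_mulMod hr, h0, natCast_pred_eq_neg_one] at this
  simp [evalList] at this

/-- The polynomial with the given coefficients, constant term first. -/
noncomputable def ofList : List ℕ → k[X]
  | [] => 0
  | c :: l => C (c : k) + X * ofList l

theorem eval_ofList (x : k) (l : List ℕ) : (ofList l).eval x = evalList x l := by
  induction l with
  | nil => simp [ofList, evalList]
  | cons c l ih => simp [ofList, evalList, ih]

theorem degree_ofList_lt (l : List ℕ) : (ofList l : k[X]).degree < l.length := by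
  induction l with
  | nil => simp [ofList]
  | cons c l ih =>
    have h : (ofList (c :: l) : k[X]) ∈ degreeLT k (l.length + 1) := by
      rw [ofList]
      refine Submodule.add_mem _ ?_ ?_
      · rw [mem_degreeLT]
        exact lt_of_le_of_lt degree_C_le (by exact_mod_cast Nat.succ_pos _)
      · rw [mem_degreeLT, mul_comm]
        by_cases h0 : (ofList l : k[X]) = 0
        · rw [h0, zero_mul, degree_zero]; exact WithBot.bot_lt_coe _
        · rw [degree_mul_X]
          rw [degree_eq_natDegree h0] at ih ⊢
          have : (ofList l : k[X]).natDegree < l.length := by exact_mod_cast ih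
          exact_mod_cast Nat.succ_lt_succ this
    simpa [mem_degreeLT] using h

theorem card_le_length {ι : Type} (ζ : ι → k) (hζ : Function.Injective ζ) (s : Finset ι)
    (r : List ℕ) (h : ∀ i ∈ s, ζ i ^ r.length = evalList (ζ i) r) : s.card ≤ r.length := by
  classical
  have hd : (X ^ r.length - ofList r : k[X]).degree = r.length := by
    rw [degree_sub_eq_left_of_degree_lt]
    · simp
    · simpa using degree_ofList_lt r
  have h0 : (X ^ r.length - ofList r : k[X]) ≠ 0 := by
    intro h; rw [h] at hd; simp at hd
  rw [← Finset.card_image_of_injective s hζ, ← natDegree_eq_of_degree_eq_some hd]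
  refine Polynomial.card_le_degree_of_subset_roots fun y hy => ?_
  obtain ⟨i, hi, rfl⟩ := Finset.mem_image.1 hy
  rw [mem_roots h0]
  simp [eval_ofList, h i hi]

/-- The element `x` is a root of one of the monic polynomials `X ^ n - r` and `X ^ m - s`, where
`n` and `m` are the lengths of `r` and `s`. -/
def IsRootOfFactors (r s : List ℕ) (x : k) : Prop :=
  x ^ r.length = evalList x r ∨ x ^ s.length = evalList x s

theorem card_filter_frobenius_fixed [Fact p.Prime] [DecidableEq k] (ζ : Fin 12 → k)
    (hζ : Function.Injective ζ) {m : ℕ} {r s u : List ℕ}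
    (hfac : ∀ i, IsRootOfFactors r s (ζ i))
    (hlen : r.length + s.length = 12) (hr : r = [] ∨ allZero (frobSubMod p r m) = true)
    (hs : inverseMod p s u (frobSubMod p s m) = true) :
    (Finset.univ.filter fun i => ζ i ^ p ^ m = ζ i).card = r.length := by
  have h1 : (Finset.univ.filter fun i => ζ i ^ p ^ m = ζ i).card ≤ r.length := by
    refine card_le_length ζ hζ _ r fun i hi => ?_
    refine (hfac i).resolve_right fun h => ?_
    apply evalList_ne_zero_of_inverseMod h hs
    rw [evalList_frobSubMod h, (Finset.mem_filter.1 hi).2, sub_self]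
  have h2 : (Finset.univ.filter fun i => ¬ ζ i ^ p ^ m = ζ i).card ≤ s.length := by
    refine card_le_length ζ hζ _ s fun i hi => ?_
    refine (hfac i).resolve_left fun h => (Finset.mem_filter.1 hi).2 ?_
    rcases hr with rfl | hr
    · simp [evalList] at h
    · rw [← sub_eq_zero, ← evalList_frobSubMod h]
      exact evalList_eq_zero _ _ hr
  have h3 := Finset.card_filter_add_card_filter_not (s := (Finset.univ : Finset (Fin 12)))
    (fun i => ζ i ^ p ^ m = ζ i)
  rw [Finset.card_univ, Fintype.card_fin] at h3
  omega

end ListArithmetic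

section FrobeniusFactorizations

variable {k : Type} [Field k]

/-- The derivative of `quartic a z` in `z`. -/
def quarticDeriv (a z : k) : k :=
  4 * z ^ 3 + 900 * z ^ 2 + 50 * (870 - 24 * a) * z + 125 * (220 - 16 * a)

/-- The derivative of `dodecic a t z` in `z`. -/
def dodecicDeriv (a t z : k) : k :=
  3 * quartic a z ^ 2 * quarticDeriv a z +
    2 * (2 ^ 12 * 3 ^ 15 * 5 ^ 7 * (118 * a - 475) * t) * z

theorem injective_of_dodecicDeriv_ne_zero {a t : k} {ζ : Fin 12 → k}
    (hζ : ∏ i, (X - C (ζ i)) = dodecic (C a) (C t) X) (h : ∀ i, dodecicDeriv a t (ζ i) ≠ 0) :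
    Function.Injective ζ := by
  have hder : ∀ y, (derivative (dodecic (C a) (C t) X)).eval y = dodecicDeriv a t y := by
    intro y
    have h1 : (dodecic (C a) (C t) X : k[X]) =
        (X ^ 4 + C 300 * X ^ 3 + C (25 * (870 - 24 * a)) * X ^ 2 +
          C (125 * (220 - 16 * a)) * X + C (625 * (648 * a - 6399))) ^ 3 +
          C (2 ^ 12 * 3 ^ 15 * 5 ^ 7 * (118 * a - 475) * t) * X ^ 2 := by
      simp [dodecic, quartic, map_ofNat]
    rw [h1]
    simp [derivative_pow]
    simp only [dodecicDeriv, quarticDeriv, quartic]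
    ring
  intro i j hij
  by_contra hne
  apply h j
  rw [← hder, ← hζ, ← Finset.mul_prod_erase _ _ (Finset.mem_univ j),
    ← Finset.mul_prod_erase _ _ (Finset.mem_erase.2 ⟨hne, Finset.mem_univ i⟩), hij]
  simp [derivative_mul]

theorem dodecicDeriv_7_2 (hp : (7 : k) = 0) (x : k) :
    dodecicDeriv 4 2 x = evalList x [4, 2, 6, 0, 0, 3, 0, 1, 4, 6, 2, 5] := by
  simp only [dodecicDeriv, quarticDeriv, quartic, evalList, Nat.cast_ofNat, Nat.cast_zero,
    Nat.cast_one]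
  linear_combination ((47313340764508928) + (85251877272723214) * x ^ 1 + (-121752130580358) *
      x ^ 2 + (-1552647360937500) * x ^ 3 + (-43504340625000) * x ^ 4 + (6005763803571) * x ^ 5 +
      (340226325000) * x ^ 6 + (7286547857) * x ^ 7 + (79570928) * x ^ 8 + (468642) * x ^ 9 +
      (1414) * x ^ 10 + (1) * x ^ 11) * hp

theorem dodecic_factor_7_2_1 (hp : (7 : k) = 0) {x : k} (h : dodecic 4 2 x = 0) :
    IsRootOfFactors [5]
      [3, 0, 3, 1, 3, 2, 4, 4, 1, 2, 5] x := by
  change x ^ 1 = _ ∨ x ^ 11 = _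
  rw [← sub_eq_zero, ← sub_eq_zero (a := x ^ 11), ← mul_eq_zero]
  simp only [dodecic, quartic, evalList, Nat.cast_ofNat, Nat.cast_zero, Nat.cast_one] at h ⊢
  linear_combination h + ((1924379148402622770) + (-47313340764508929) * x ^ 1 +
      (-42625938636361605) * x ^ 2 + (40584043526786) * x ^ 3 + (388161840234377) * x ^ 4 +
      (8700868125001) * x ^ 5 + (-1000960633926) * x ^ 6 + (-48603760712) * x ^ 7 + (-910818482) *
      x ^ 8 + (-8841213) * x ^ 9 + (-46861) * x ^ 10 + (-130) * x ^ 11) * hp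

theorem dodecicDeriv_23_14 (hp : (23 : k) = 0) (x : k) :
    dodecicDeriv 8 14 x = evalList x [0, 11, 4, 21, 3, 5, 3, 16, 1, 0, 10, 12] := by
  simp only [dodecicDeriv, quarticDeriv, quartic, evalList, Nat.cast_ofNat, Nat.cast_zero,
    Nat.cast_one]
  linear_combination ((864975585937500) + (2624156249232350543) * x ^ 1 + (-47950539741848) *
      x ^ 2 + (-115091340285327) * x ^ 3 + (-2867384103261) * x ^ 4 + (1288377244565) * x ^ 5 +
      (79580846739) * x ^ 6 + (1898027608) * x ^ 7 + (22517413) * x ^ 8 + (139500) * x ^ 9 +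
      (430) * x ^ 10) * hp

theorem dodecic_factor_23_14_1 (hp : (23 : k) = 0) {x : k} (h : dodecic 8 14 x = 0) :
    IsRootOfFactors []
      [21, 0, 6, 14, 12, 4, 3, 16, 21, 5, 0, 20] x := by
  change x ^ 0 = _ ∨ x ^ 12 = _
  rw [← sub_eq_zero, ← sub_eq_zero (a := x ^ 12), ← mul_eq_zero]
  simp only [dodecic, quartic, evalList, Nat.cast_ofNat, Nat.cast_zero, Nat.cast_one] at h ⊢
  linear_combination h + ((19038864799167798) + (-864975585937500) * x ^ 1 +
      (-1312078124616175272) * x ^ 2 + (15983513247282) * x ^ 3 + (28772835071331) * x ^ 4 +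
      (573476820652) * x ^ 5 + (-214729540761) * x ^ 6 + (-11368692392) * x ^ 7 + (-237253452) *
      x ^ 8 + (-2501935) * x ^ 9 + (-13950) * x ^ 10 + (-40) * x ^ 11) * hp

theorem dodecic_factor_23_14_2 (hp : (23 : k) = 0) {x : k} (h : dodecic 8 14 x = 0) :
    IsRootOfFactors [8, 6]
      [6, 7, 12, 16, 11, 22, 19, 21, 7, 14] x := by
  change x ^ 2 = _ ∨ x ^ 10 = _
  rw [← sub_eq_zero, ← sub_eq_zero (a := x ^ 10), ← mul_eq_zero]
  simp only [dodecic, quartic, evalList, Nat.cast_ofNat, Nat.cast_zero, Nat.cast_one] at h ⊢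
  linear_combination h + ((19038864799167801) + (-864975585937496) * x ^ 1 +
      (-1312078124616175266) * x ^ 2 + (15983513247291) * x ^ 3 + (28772835071339) * x ^ 4 +
      (573476820662) * x ^ 5 + (-214729540749) * x ^ 6 + (-11368692380) * x ^ 7 + (-237253444) *
      x ^ 8 + (-2501929) * x ^ 9 + (-13947) * x ^ 10 + (-40) * x ^ 11) * hp

theorem dodecicDeriv_7_6 (hp : (7 : k) = 0) (x : k) :
    dodecicDeriv 4 6 x = evalList x [4, 3, 6, 0, 0, 3, 0, 1, 4, 6, 2, 5] := by
  simp only [dodecicDeriv, quarticDeriv, quartic, evalList, Nat.cast_ofNat, Nat.cast_zero,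
    Nat.cast_one]
  linear_combination ((47313340764508928) + (69509076449866071) * x ^ 1 + (-121752130580358) *
      x ^ 2 + (-1552647360937500) * x ^ 3 + (-43504340625000) * x ^ 4 + (6005763803571) * x ^ 5 +
      (340226325000) * x ^ 6 + (7286547857) * x ^ 7 + (79570928) * x ^ 8 + (468642) * x ^ 9 +
      (1414) * x ^ 10 + (1) * x ^ 11) * hp

theorem dodecic_factor_7_6_1 (hp : (7 : k) = 0) {x : k} (h : dodecic 4 6 x = 0) :
    IsRootOfFactors [1, 0]
      [1, 4, 6, 6, 6, 6, 3, 1, 4, 3] x := by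
  change x ^ 2 = _ ∨ x ^ 10 = _
  rw [← sub_eq_zero, ← sub_eq_zero (a := x ^ 10), ← mul_eq_zero]
  simp only [dodecic, quartic, evalList, Nat.cast_ofNat, Nat.cast_zero, Nat.cast_one] at h ⊢
  linear_combination h + ((1924379148402622768) + (-47313340764508928) * x ^ 1 +
      (-34754538224933035) * x ^ 2 + (40584043526786) * x ^ 3 + (388161840234375) * x ^ 4 +
      (8700868125000) * x ^ 5 + (-1000960633929) * x ^ 6 + (-48603760715) * x ^ 7 + (-910818482) *
      x ^ 8 + (-8841214) * x ^ 9 + (-46865) * x ^ 10 + (-129) * x ^ 11) * hp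

theorem dodecic_factor_7_6_2 (hp : (7 : k) = 0) {x : k} (h : dodecic 4 6 x = 0) :
    IsRootOfFactors [6, 6, 2, 1]
      [6, 4, 3, 2, 2, 1, 5, 2] x := by
  change x ^ 4 = _ ∨ x ^ 8 = _
  rw [← sub_eq_zero, ← sub_eq_zero (a := x ^ 8), ← mul_eq_zero]
  simp only [dodecic, quartic, evalList, Nat.cast_ofNat, Nat.cast_zero, Nat.cast_one] at h ⊢
  linear_combination h + ((1924379148402622773) + (-47313340764508920) * x ^ 1 +
      (-34754538224933028) * x ^ 2 + (40584043526792) * x ^ 3 + (388161840234379) * x ^ 4 +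
      (8700868125003) * x ^ 5 + (-1000960633923) * x ^ 6 + (-48603760708) * x ^ 7 + (-910818480) *
      x ^ 8 + (-8841214) * x ^ 9 + (-46865) * x ^ 10 + (-129) * x ^ 11) * hp

theorem dodecicDeriv_7_4 (hp : (7 : k) = 0) (x : k) :
    dodecicDeriv 4 4 x = evalList x [4, 6, 6, 0, 0, 3, 0, 1, 4, 6, 2, 5] := by
  simp only [dodecicDeriv, quarticDeriv, quartic, evalList, Nat.cast_ofNat, Nat.cast_zero,
    Nat.cast_one]
  linear_combination ((47313340764508928) + (77380476861294642) * x ^ 1 + (-121752130580358) *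
      x ^ 2 + (-1552647360937500) * x ^ 3 + (-43504340625000) * x ^ 4 + (6005763803571) * x ^ 5 +
      (340226325000) * x ^ 6 + (7286547857) * x ^ 7 + (79570928) * x ^ 8 + (468642) * x ^ 9 +
      (1414) * x ^ 10 + (1) * x ^ 11) * hp

theorem dodecic_factor_7_4_2 (hp : (7 : k) = 0) {x : k} (h : dodecic 4 4 x = 0) :
    IsRootOfFactors [6, 5, 3]
      [6, 5, 5, 4, 2, 3, 6, 0, 0] x := by
  change x ^ 3 = _ ∨ x ^ 9 = _
  rw [← sub_eq_zero, ← sub_eq_zero (a := x ^ 9), ← mul_eq_zero]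
  simp only [dodecic, quartic, evalList, Nat.cast_ofNat, Nat.cast_zero, Nat.cast_one] at h ⊢
  linear_combination h + ((1924379148402622773) + (-47313340764508920) * x ^ 1 +
      (-38690238430647311) * x ^ 2 + (40584043526794) * x ^ 3 + (388161840234381) * x ^ 4 +
      (8700868125005) * x ^ 5 + (-1000960633921) * x ^ 6 + (-48603760709) * x ^ 7 + (-910818480) *
      x ^ 8 + (-8841216) * x ^ 9 + (-46865) * x ^ 10 + (-129) * x ^ 11) * hp

end FrobeniusFactorizations

section FrobeniusCycles

/-- The subgroup `H` contains the permutation by which the `p`-power map acts on the roots of the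
degree twelve polynomial with parameters `a`, `t` in characteristic `p`. -/
def HasFrobenius (H : Subgroup (Equiv.Perm (Fin 12))) (p a t : ℕ) : Prop :=
  ∃ (k : Type) (_ : Field k) (_ : CharP k p) (ζ : Fin 12 → k),
    ∏ i, (X - C (ζ i)) = dodecic (C (a : k)) (C (t : k)) X ∧
      ∃ τ ∈ H, ∀ i, ζ (τ i) = ζ i ^ p

variable {k : Type} [Field k] {ζ : Fin 12 → k} {τ : Equiv.Perm (Fin 12)} {p : ℕ}

theorem dodecic_eq_zero_of_prod_eq {R : Type} [CommRing R] {a t : R} {z : Fin 12 → R}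
    (hz : ∏ i, (X - C (z i)) = dodecic (C a) (C t) X) (i : Fin 12) : dodecic a t (z i) = 0 := by
  have h := congrArg (evalRingHom (z i)) hz
  rw [map_dodecic, map_prod, Finset.prod_eq_zero (Finset.mem_univ i) (by simp)] at h
  simpa using h.symm

theorem apply_pow_perm (hτ : ∀ i, ζ (τ i) = ζ i ^ p) (m : ℕ) (i : Fin 12) :
    ζ ((τ ^ m) i) = ζ i ^ p ^ m := by
  induction m with
  | zero => simp
  | succ m ih => rw [pow_succ', Equiv.Perm.mul_apply, hτ, ih, ← pow_mul, ← pow_succ]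

variable [CharP k p] [Fact p.Prime]

theorem fixCount_pow_eq_length (hζ : Function.Injective ζ) (hτ : ∀ i, ζ (τ i) = ζ i ^ p) {m : ℕ}
    {r s : List ℕ} (u : List ℕ)
    (hfac : ∀ i, IsRootOfFactors r s (ζ i))
    (hlen : r.length + s.length = 12) (hr : r = [] ∨ allZero (frobSubMod p r m) = true)
    (hs : inverseMod p s u (frobSubMod p s m) = true) : fixCount (τ ^ m) = r.length := by
  classical
  rw [fixCount, ← card_filter_frobenius_fixed ζ hζ hfac hlen hr hs]
  congr 1
  ext i
  simp only [Finset.mem_filter, Finset.mem_univ, true_and]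
  rw [← apply_pow_perm hτ, hζ.eq_iff]

theorem perm_pow_eq_one (hζ : Function.Injective ζ) (hτ : ∀ i, ζ (τ i) = ζ i ^ p) {m : ℕ}
    {r s : List ℕ}
    (hfac : ∀ i, IsRootOfFactors r s (ζ i))
    (hr : allZero (frobSubMod p r m) = true) (hs : allZero (frobSubMod p s m) = true) :
    τ ^ m = 1 := by
  ext1 i
  apply hζ
  rw [apply_pow_perm hτ, Equiv.Perm.one_apply, ← sub_eq_zero]
  rcases hfac i with h | h
  · rw [← evalList_frobSubMod h]; exact evalList_eq_zero _ _ hr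
  · rw [← evalList_frobSubMod h]; exact evalList_eq_zero _ _ hs

theorem injective_of_inverseMod {a t : k}
    (hprod : ∏ i, (X - C (ζ i)) = dodecic (C a) (C t) X) {d r s : List ℕ} (u v : List ℕ)
    (hd : ∀ x, dodecicDeriv a t x = evalList x d)
    (hfac : ∀ i, IsRootOfFactors r s (ζ i))
    (hr : inverseMod p r u d = true) (hs : inverseMod p s v d = true) :
    Function.Injective ζ := by
  refine injective_of_dodecicDeriv_ne_zero hprod fun i => ?_
  rw [hd]
  rcases hfac i with h | h
  · exact evalList_ne_zero_of_inverseMod h hr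
  · exact evalList_ne_zero_of_inverseMod h hs

end FrobeniusCycles

section FrobeniusTypes

variable {H : Subgroup (Equiv.Perm (Fin 12))}

theorem exists_cycle_eleven (h : HasFrobenius H 7 4 2) :
    ∃ τ ∈ H, fixCount τ = 1 ∧ τ ^ 11 = 1 := by
  obtain ⟨k, _, _, ζ, hprod, τ, hτH, hτ⟩ := h
  have : Fact (Nat.Prime 7) := ⟨by norm_num⟩
  have hp : (7 : k) = 0 := by exact_mod_cast CharP.cast_eq_zero k 7
  have hroot := dodecic_eq_zero_of_prod_eq hprod
  push_cast at hprod hroot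
  have hd := dodecicDeriv_7_2 hp
  have hfac1 := fun i => dodecic_factor_7_2_1 hp (hroot i)
  have hinj : Function.Injective ζ := injective_of_inverseMod (p := 7) hprod
    [2]
    [4, 2, 3, 1, 5, 6, 5, 6, 5, 4, 1] hd hfac1 (by decide +kernel) (by decide +kernel)
  have h11 : τ ^ 11 = 1 := perm_pow_eq_one hinj hτ hfac1 (by decide +kernel) (by decide +kernel)
  have hm1 := fixCount_pow_eq_length hinj hτ (m := 1) [5, 4, 4, 6, 3, 2, 6, 5, 2, 2, 1] hfac1
    rfl (Or.inr (by decide +kernel)) (by decide +kernel)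
  rw [pow_one] at hm1
  exact ⟨τ, hτH, hm1, h11⟩

theorem exists_cycle_ten (h : HasFrobenius H 23 8 14) :
    ∃ τ ∈ H, fixCount τ = 0 ∧ fixCount (τ ^ 2) = 2 ∧ τ ^ 10 = 1 := by
  obtain ⟨k, _, _, ζ, hprod, τ, hτH, hτ⟩ := h
  have : Fact (Nat.Prime 23) := ⟨by norm_num⟩
  have hp : (23 : k) = 0 := by exact_mod_cast CharP.cast_eq_zero k 23
  have hroot := dodecic_eq_zero_of_prod_eq hprod
  push_cast at hprod hroot
  have hd := dodecicDeriv_23_14 hp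
  have hfac1 := fun i => dodecic_factor_23_14_1 hp (hroot i)
  have hfac2 := fun i => dodecic_factor_23_14_2 hp (hroot i)
  have hinj : Function.Injective ζ := injective_of_inverseMod (p := 23) hprod
    [10, 21]
    [11, 4, 16, 4, 2, 9, 3, 7, 15, 22] hd hfac2 (by decide +kernel) (by decide +kernel)
  have h10 : τ ^ 10 = 1 := perm_pow_eq_one hinj hτ hfac2 (by decide +kernel) (by decide +kernel)
  have hm1 := fixCount_pow_eq_length hinj hτ (m := 1) [4, 22, 22, 14, 11, 12, 14, 16, 7, 20, 14,
      3] hfac1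
    rfl (Or.inl rfl) (by decide +kernel)
  rw [pow_one] at hm1
  have hm2 := fixCount_pow_eq_length hinj hτ (m := 2) [9, 1, 17, 13, 3, 9, 13, 3, 6, 7] hfac2
    rfl (Or.inr (by decide +kernel)) (by decide +kernel)
  exact ⟨τ, hτH, hm1, hm2, h10⟩

theorem exists_cycle_eight (h : HasFrobenius H 7 4 6) :
    ∃ τ ∈ H, fixCount τ = 2 ∧ fixCount (τ ^ 2) = 4 ∧ fixCount (τ ^ 4) = 4 ∧ τ ^ 8 = 1 := by
  obtain ⟨k, _, _, ζ, hprod, τ, hτH, hτ⟩ := h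
  have : Fact (Nat.Prime 7) := ⟨by norm_num⟩
  have hp : (7 : k) = 0 := by exact_mod_cast CharP.cast_eq_zero k 7
  have hroot := dodecic_eq_zero_of_prod_eq hprod
  push_cast at hprod hroot
  have hd := dodecicDeriv_7_6 hp
  have hfac1 := fun i => dodecic_factor_7_6_1 hp (hroot i)
  have hfac2 := fun i => dodecic_factor_7_6_2 hp (hroot i)
  have hinj : Function.Injective ζ := injective_of_inverseMod (p := 7) hprod
    [1, 5]
    [0, 1, 2, 1, 1, 0, 6, 4, 4, 0] hd hfac1 (by decide +kernel) (by decide +kernel)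
  have h8 : τ ^ 8 = 1 := perm_pow_eq_one hinj hτ hfac1 (by decide +kernel) (by decide +kernel)
  have hm1 := fixCount_pow_eq_length hinj hτ (m := 1) [0, 5, 4, 1, 5, 2, 2, 4, 4, 5] hfac1
    rfl (Or.inr (by decide +kernel)) (by decide +kernel)
  rw [pow_one] at hm1
  have hm2 := fixCount_pow_eq_length hinj hτ (m := 2) [6, 2, 6, 2, 6, 3, 2, 2] hfac2
    rfl (Or.inr (by decide +kernel)) (by decide +kernel)
  have hm4 := fixCount_pow_eq_length hinj hτ (m := 4) [5, 2, 6, 5, 0, 4, 2, 5] hfac2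
    rfl (Or.inr (by decide +kernel)) (by decide +kernel)
  exact ⟨τ, hτH, hm1, hm2, hm4, h8⟩

theorem exists_cycle_six (h : HasFrobenius H 7 4 4) :
    ∃ τ ∈ H, fixCount (τ ^ 2) = 3 ∧ τ ^ 6 = 1 := by
  obtain ⟨k, _, _, ζ, hprod, τ, hτH, hτ⟩ := h
  have : Fact (Nat.Prime 7) := ⟨by norm_num⟩
  have hp : (7 : k) = 0 := by exact_mod_cast CharP.cast_eq_zero k 7
  have hroot := dodecic_eq_zero_of_prod_eq hprod
  push_cast at hprod hroot
  have hd := dodecicDeriv_7_4 hp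
  have hfac2 := fun i => dodecic_factor_7_4_2 hp (hroot i)
  have hinj : Function.Injective ζ := injective_of_inverseMod (p := 7) hprod
    [2, 6, 3]
    [2, 0, 6, 0, 1, 5, 5, 1, 3] hd hfac2 (by decide +kernel) (by decide +kernel)
  have h6 : τ ^ 6 = 1 := perm_pow_eq_one hinj hτ hfac2 (by decide +kernel) (by decide +kernel)
  have hm2 := fixCount_pow_eq_length hinj hτ (m := 2) [0, 2, 4, 5, 1, 0, 5, 0, 5] hfac2
    rfl (Or.inr (by decide +kernel)) (by decide +kernel)
  exact ⟨τ, hτH, hm2, h6⟩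

end FrobeniusTypes

section RootPermutations

theorem exists_perm_hom {B H ι : Type} [Monoid B] [Group H] [MulAction H B] {z : ι → B}
    (hz : Function.Injective z) (h : ∀ (g : H) i, ∃ j, g • z i = z j) :
    ∃ π : H →* Equiv.Perm ι, ∀ g i, g • z i = z (π g i) := by
  choose f hf using h
  let F : H →* Function.End ι :=
    { toFun := f
      map_one' := by
        funext i
        apply hz
        rw [← hf, one_smul]
        rfl
      map_mul' := fun g g' => by
        funext i
        apply hz
        change z (f (g * g') i) = z (f g (f g' i))
        rw [← hf, ← hf, ← hf, mul_smul] }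
  exact ⟨F.toHomPerm, hf⟩

variable {B : Type} [CommRing B]

theorem exists_root_eq [IsDomain B] {a t x : B} {z : Fin 12 → B}
    (hz : ∏ i, (X - C (z i)) = dodecic (C a) (C t) X) (hx : dodecic a t x = 0) :
    ∃ i, x = z i := by
  have h := congrArg (evalRingHom x) hz
  rw [map_dodecic, map_prod] at h
  simp only [coe_evalRingHom, eval_C, eval_X, hx, eval_sub] at h
  obtain ⟨i, -, hi⟩ := Finset.prod_eq_zero_iff.1 h
  exact ⟨i, sub_eq_zero.1 hi⟩

theorem prod_map_eq {k : Type} [CommRing k] (φ : B →+* k) {a t : B} {z : Fin 12 → B}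
    (hz : ∏ i, (X - C (z i)) = dodecic (C a) (C t) X) :
    ∏ i, (X - C (φ (z i))) = dodecic (C (φ a)) (C (φ t)) X := by
  have h := congrArg (mapRingHom φ) hz
  rw [map_dodecic, map_prod] at h
  simpa using h

/-- Renumbering: a reduction splitting the polynomial into known distinct roots provides a
numbering of the roots compatible with the one of their reductions. -/
theorem exists_numbering {k : Type} [Field k] (φ : B →+* k) {a t : B} {z : Fin 12 → B}
    (hz : ∏ i, (X - C (z i)) = dodecic (C a) (C t) X) {r : Fin 12 → k}
    (hr : Function.Injective r) (h : ∀ i, dodecic (φ a) (φ t) (r i) = 0) :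
    ∃ z' : Fin 12 → B, ∏ i, (X - C (z' i)) = dodecic (C a) (C t) X ∧
      (∀ i, φ (z' i) = r i) ∧ ∀ i, ∃ j, z i = z' j := by
  choose f hf using fun i => exists_root_eq (prod_map_eq φ hz) (h i)
  have hinj : Function.Injective f := fun i j hij => hr (by rw [hf i, hf j, hij])
  have hbij : Function.Bijective f := Finite.injective_iff_bijective.1 hinj
  refine ⟨z ∘ f, ?_, fun i => (hf i).symm, fun i => ?_⟩
  · rw [← hz]
    exact (Equiv.ofBijective f hbij).prod_comp fun i => X - C (z i)
  · obtain ⟨j, rfl⟩ := hbij.2 i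
    exact ⟨j, rfl⟩

end RootPermutations

section Signs

theorem intCast_injective_of_emod {k : Type} [Field k] {p : ℕ} [CharP k p] {r : Fin 12 → ℤ}
    (h : ∀ i j, (r i - r j) % p = 0 → i = j) : Function.Injective fun i => (r i : k) := by
  intro i j hij
  apply h
  rw [← Int.dvd_iff_emod_eq_zero, ← CharP.intCast_eq_zero_iff k, Int.cast_sub]
  exact sub_eq_zero.2 hij

theorem splitRoots_distinct : ∀ i j : Fin 12,
    (splitRoots i - splitRoots j) % (3121 : ℕ) = 0 → i = j := by
  decide +kernel

theorem splitConjRoots_distinct : ∀ i j : Fin 12,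
    (splitConjRoots i - splitConjRoots j) % (3121 : ℕ) = 0 → i = j := by
  decide +kernel

theorem dodecic_splitRoots : ∀ i : Fin 12, dodecic 256 447 (splitRoots i) % (3121 : ℕ) = 0 := by
  decide +kernel

theorem dodecic_splitConjRoots : ∀ j : Fin 12,
    dodecic (-256) 447 (splitConjRoots j) % (3121 : ℕ) = 0 := by
  decide +kernel

theorem intCast_eq_zero_of_emod {k : Type} [Field k] {p : ℕ} [CharP k p] {n : ℤ} (h : n % p = 0) :
    (n : k) = 0 :=
  (CharP.intCast_eq_zero_iff k p n).2 (Int.dvd_of_emod_eq_zero h)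

variable {k : Type} [Field k] [CharP k 3121]

theorem cast_dodecic_splitRoots (i : Fin 12) :
    dodecic (256 : k) 447 (splitRoots i : ℤ) = 0 := by
  have h := intCast_eq_zero_of_emod (k := k) (dodecic_splitRoots i)
  rw [← eq_intCast (Int.castRingHom k), map_dodecic] at h
  simpa using h

theorem cast_dodecic_splitConjRoots (j : Fin 12) :
    dodecic (-256 : k) 447 (splitConjRoots j : ℤ) = 0 := by
  have h := intCast_eq_zero_of_emod (k := k) (dodecic_splitConjRoots j)
  rw [← eq_intCast (Int.castRingHom k), map_dodecic] at h
  simpa using h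

theorem cast_split_rootNum (i j : Fin 12) :
    rootNum (256 : k) (splitRoots i : ℤ) (splitConjRoots j : ℤ) =
      (hadamard i j : ℤ) * ((splitRowFactors i : ℤ) * (splitColFactors j : ℤ)) *
        rootDen (256 : k) (splitRoots i : ℤ) (splitConjRoots j : ℤ) := by
  have h := intCast_eq_zero_of_emod (k := k) (p := 3121) (split_rootNum i j)
  rw [← eq_intCast (Int.castRingHom k), map_sub, map_mul, map_rootNum, map_rootDen] at h
  simpa [sub_eq_zero] using h

theorem cast_split_rootDen_ne_zero (i j : Fin 12) :
    ((splitRowFactors i : ℤ) : k) * (splitColFactors j : ℤ) *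
      rootDen (256 : k) (splitRoots i : ℤ) (splitConjRoots j : ℤ) ≠ 0 := by
  have h := mt (fun h => Int.emod_eq_zero_of_dvd ((CharP.intCast_eq_zero_iff k 3121 _).1 h))
    (split_rootDen i j)
  rw [← eq_intCast (Int.castRingHom k), map_mul, map_rootDen] at h
  simpa using h

variable {B : Type} [CommRing B] [IsDomain B]

/-- The sign relations, read off from a reduction modulo `3121`. -/
theorem cross_ratio_relation (φ : B →+* k) {a t : B} {z w : Fin 12 → B} (ha : a ^ 2 = -5)
    (hφ : φ a = 256) (hz : ∀ i, dodecic a t (z i) = 0) (hw : ∀ j, dodecic (-a) t (w j) = 0)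
    (hφz : ∀ i, φ (z i) = (splitRoots i : ℤ)) (hφw : ∀ j, φ (w j) = (splitConjRoots j : ℤ))
    (i l j m : Fin 12) :
    rootNum a (z i) (w j) * rootNum a (z l) (w m) *
        (rootDen a (z i) (w m) * rootDen a (z l) (w j)) =
      ((hadamard i j * hadamard l m * (hadamard i m * hadamard l j) : ℤ) : B) *
        (rootNum a (z i) (w m) * rootNum a (z l) (w j) *
          (rootDen a (z i) (w j) * rootDen a (z l) (w m))) ∧
      φ (rootNum a (z i) (w m) * rootNum a (z l) (w j) *
          (rootDen a (z i) (w j) * rootDen a (z l) (w m))) ≠ 0 := by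
  have hunit : ∀ i j, hadamard i j = 1 ∨ hadamard i j = -1 := fun i j =>
    mul_self_eq_one_iff.1 (hadamard_sq i j)
  have hcast : ∀ i j, ((hadamard i j : ℤ) : k) ≠ 0 := fun i j => by
    rcases hunit i j with h | h <;> simp [h]
  have hN : ∀ i j, φ (rootNum a (z i) (w j)) = (hadamard i j : ℤ) *
      ((splitRowFactors i : ℤ) * (splitColFactors j : ℤ)) * φ (rootDen a (z i) (w j)) := by
    intro i j
    rw [map_rootNum, map_rootDen, hφ, hφz, hφw, cast_split_rootNum]
  have hD : ∀ i j, ((splitRowFactors i : ℤ) : k) * (splitColFactors j : ℤ) *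
      φ (rootDen a (z i) (w j)) ≠ 0 := by
    intro i j
    rw [map_rootDen, hφ, hφz, hφw]
    exact cast_split_rootDen_ne_zero i j
  have hne : φ (rootNum a (z i) (w m) * rootNum a (z l) (w j) *
      (rootDen a (z i) (w j) * rootDen a (z l) (w m))) ≠ 0 := by
    have h1 := hD i m
    have h2 := hD l j
    have h3 := right_ne_zero_of_mul (hD i j)
    have h4 := right_ne_zero_of_mul (hD l m)
    rw [map_mul, map_mul, map_mul, hN, hN, mul_assoc ((hadamard i m : ℤ) : k),
      mul_assoc ((hadamard l j : ℤ) : k)]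
    exact mul_ne_zero (mul_ne_zero (mul_ne_zero (hcast _ _) h1) (mul_ne_zero (hcast _ _) h2))
      (mul_ne_zero h3 h4)
  refine ⟨?_, hne⟩
  have hsq := cross_sq_eq ha (hz i) (hz l) (hw j) (hw m)
  have hred : φ (rootNum a (z i) (w j) * rootNum a (z l) (w m) *
        (rootDen a (z i) (w m) * rootDen a (z l) (w j))) =
      ((hadamard i j * hadamard l m * (hadamard i m * hadamard l j) : ℤ) : k) *
        φ (rootNum a (z i) (w m) * rootNum a (z l) (w j) *
          (rootDen a (z i) (w j) * rootDen a (z l) (w m))) := by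
    have hs : ∀ i j, ((hadamard i j : ℤ) : k) * (hadamard i j : ℤ) = 1 := fun i j => by
      exact_mod_cast congrArg (Int.cast (R := k)) (hadamard_sq i j)
    simp only [map_mul, hN, Int.cast_mul]
    have e1 := hs i m
    have e2 := hs l j
    linear_combination (-(hadamard i j : k) * hadamard l m * splitRowFactors i *
      splitRowFactors l * splitColFactors j * splitColFactors m *
      φ (rootDen a (z i) (w j)) * φ (rootDen a (z l) (w m)) * φ (rootDen a (z i) (w m)) *
      φ (rootDen a (z l) (w j))) * (e1 * ((hadamard l j : ℤ) * (hadamard l j : ℤ)) + e2)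
  have h2 : (2 : k) ≠ 0 := by
    intro h
    have : ((2 : ℕ) : k) = 0 := by exact_mod_cast h
    rw [CharP.cast_eq_zero_iff k 3121] at this
    omega
  generalize rootNum a (z i) (w j) * rootNum a (z l) (w m) *
        (rootDen a (z i) (w m) * rootDen a (z l) (w j)) = x at *
  generalize rootNum a (z i) (w m) * rootNum a (z l) (w j) *
          (rootDen a (z i) (w j) * rootDen a (z l) (w m)) = y at *
  have hη : hadamard i j * hadamard l m * (hadamard i m * hadamard l j) = 1 ∨
      hadamard i j * hadamard l m * (hadamard i m * hadamard l j) = -1 := by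
    rcases hunit i j with h | h <;> rcases hunit l m with h' | h' <;>
      rcases hunit i m with h'' | h'' <;> rcases hunit l j with h3 | h3 <;>
        simp [h, h', h'', h3]
  have hsame : φ y ≠ -φ y := fun h =>
    mul_ne_zero h2 hne (by rw [two_mul]; exact eq_neg_iff_add_eq_zero.1 h)
  rcases hη with h | h <;> rw [h] at hred ⊢ <;> rcases sq_eq_sq_iff_eq_or_eq_neg.1 hsq with hx | hx
  · simpa using hx
  · rw [hx, map_neg] at hred
    simp only [Int.cast_one, one_mul] at hred
    exact absurd hred.symm hsame
  · rw [hx] at hred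
    simp only [Int.cast_neg, Int.cast_one, neg_mul, one_mul] at hred
    exact absurd hred hsame
  · simpa using hx

end Signs

section GroupOrder

variable {B G : Type} [CommRing B] [IsDomain B] [Group G] [MulSemiringAction G B]

/-- For each prime and each specialization of `t` there is a reduction of `B` together with a
Frobenius element. -/
def HasFrobenii (G : Type) {B : Type} [CommRing B] [Group G] [MulSemiringAction G B] (t : B) :
    Prop :=
  ∀ (p : ℕ) [Fact p.Prime] (t₀ : ℕ), ∃ (k : Type) (_ : Field k) (_ : CharP k p) (φ : B →+* k),
    φ t = t₀ ∧ ∃ g : G, ∀ b, φ (g • b) = φ b ^ p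

theorem smul_eq_or_eq_neg {a : B} (ha : a ^ 2 = -5) (g : G) : g • a = a ∨ g • a = -a := by
  rw [← sq_eq_sq_iff_eq_or_eq_neg, ← smul_pow', ha, smul_neg]
  congr 1
  exact map_ofNat (MulSemiringAction.toRingHom G B g) 5

theorem exists_smul_eq_neg {a t : B} (ha : a ^ 2 = -5) (hF : HasFrobenii G t) :
    a ≠ -a ∧ ∃ g : G, g • a = -a := by
  have : Fact (Nat.Prime 11) := ⟨by norm_num⟩
  obtain ⟨k, _, _, φ, -, g, hg⟩ := hF 11 0
  have h11 : (11 : k) = 0 := by exact_mod_cast CharP.cast_eq_zero k 11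
  have hφ : φ a ^ 2 = -5 := by rw [← map_pow, ha, map_neg, map_ofNat]
  have hpow : φ a ^ 11 = -φ a := by
    linear_combination (φ a * (φ a ^ 8 - 5 * φ a ^ 6 + 25 * φ a ^ 4 - 125 * φ a ^ 2 + 625)) * hφ -
      284 * φ a * h11
  have hne : φ a ≠ -φ a := by
    intro h
    have h1 : (1 : k) = 0 := by
      linear_combination 20 * hφ - 10 * φ a * h - 9 * h11
    exact one_ne_zero h1
  have hg' := hg a
  rw [hpow] at hg'
  refine ⟨fun h => hne ?_, g, (smul_eq_or_eq_neg ha g).resolve_left fun h => hne ?_⟩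
  · rw [← map_neg, ← h]
  · rw [← hg', h]

/-- Over a prime at which `-5` is a square, one may prescribe the reduction of `√-5`, and the
Frobenius fixes `√-5`. -/
theorem exists_frobenius_fixing {a t : B} (ha : a ^ 2 = -5) (ht : ∀ g : G, g • t = t)
    (hF : HasFrobenii G t) (p : ℕ) [Fact p.Prime] (a₀ t₀ : ℕ) (hp : (a₀ ^ 2 + 5) % p = 0)
    (hp2 : (2 * a₀) % p ≠ 0) :
    ∃ (k : Type) (_ : Field k) (_ : CharP k p) (φ : B →+* k), φ t = t₀ ∧ φ a = a₀ ∧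
      ∃ g : G, g • a = a ∧ ∀ b, φ (g • b) = φ b ^ p := by
  obtain ⟨-, s, hs⟩ := exists_smul_eq_neg ha hF
  obtain ⟨k, _, _, φ, hφt, g, hg⟩ := hF p t₀
  have hφ : φ a ^ 2 = -5 := by rw [← map_pow, ha, map_neg, map_ofNat]
  have ha0 : (a₀ : k) ^ 2 = -5 := by
    have : ((a₀ ^ 2 + 5 : ℕ) : k) = 0 := (CharP.cast_eq_zero_iff k p _).2 (Nat.dvd_of_mod_eq_zero hp)
    push_cast at this
    exact eq_neg_of_add_eq_zero_left this
  have h2 : (a₀ : k) ≠ -a₀ := by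
    intro h
    apply hp2
    apply Nat.mod_eq_zero_of_dvd
    rw [← CharP.cast_eq_zero_iff k p]
    push_cast
    linear_combination h
  have hfrob : (a₀ : k) ^ p = a₀ := by
    have : Fact p.Prime := inferInstance
    exact (map_natCast (frobenius k p) a₀)
  rcases sq_eq_sq_iff_eq_or_eq_neg.1 (hφ.trans ha0.symm) with h | h
  · refine ⟨k, _, ‹_›, φ, hφt, h, g, (smul_eq_or_eq_neg ha g).resolve_right fun hga => h2 ?_, hg⟩
    have := hg a
    rw [hga, map_neg, h, hfrob] at this
    exact this.symm
  · refine ⟨k, _, ‹_›, φ.comp (MulSemiringAction.toRingHom G B s), ?_, ?_, s⁻¹ * g * s, ?_, ?_⟩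
    · change φ (s • t) = _
      rw [ht, hφt]
    · change φ (s • a) = _
      rw [hs, map_neg, h, neg_neg]
    · have hga : g • a = a := by
        refine (smul_eq_or_eq_neg ha g).resolve_right fun hga => h2 ?_
        have h3 := hg (s • a)
        rw [hs, smul_neg, hga, neg_neg, map_neg, h, neg_neg, hfrob] at h3
        exact h3.symm
      rw [mul_smul, mul_smul, hs, smul_neg, hga, ← hs, smul_smul, inv_mul_cancel, one_smul]
    · intro b
      change φ (s • ((s⁻¹ * g * s) • b)) = φ (s • b) ^ p
      rw [← hg, smul_smul, smul_smul]
      congr 2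
      group

theorem exists_smul_root {a t : B} (ht : ∀ g : G, g • t = t) {z : Fin 12 → B}
    (hz : ∏ i, (X - C (z i)) = dodecic (C a) (C t) X) (g : G) (hg : g • a = a) (i : Fin 12) :
    ∃ j, g • z i = z j := by
  apply exists_root_eq hz
  have h := congrArg (MulSemiringAction.toRingHom G B g) (dodecic_eq_zero_of_prod_eq hz i)
  rw [map_dodecic, map_zero] at h
  change dodecic (g • a) (g • t) (g • z i) = 0 at h
  rwa [hg, ht] at h

theorem smul_rootNum_rootDen {R : Type} [CommRing R] [MulSemiringAction G R] {a : R} (g : G)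
    (hg : g • a = a) (i l : R) :
    g • rootNum a i l = rootNum a (g • i) (g • l) ∧
      g • rootDen a i l = rootDen a (g • i) (g • l) := by
  have h1 := map_rootNum (MulSemiringAction.toRingHom G R g) a i l
  have h2 := map_rootDen (MulSemiringAction.toRingHom G R g) a i l
  change g • _ = rootNum (g • a) (g • i) (g • l) at h1
  change g • _ = rootDen (g • a) (g • i) (g • l) at h2
  rw [hg] at h1 h2
  exact ⟨h1, h2⟩

theorem card_stabilizer_eq [Finite G] {a t : B} (ha : a ^ 2 = -5) (ht : ∀ g : G, g • t = t)
    (hF : HasFrobenii G t) {z w : Fin 12 → B}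
    (hz : ∏ i, (X - C (z i)) = dodecic (C a) (C t) X)
    (hw : ∏ j, (X - C (w j)) = dodecic (C (-a)) (C t) X)
    (hfaith : ∀ g : G, (∀ i, g • z i = z i) → (∀ j, g • w j = w j) → g = 1) :
    Nat.card (MulAction.stabilizer G a) = 95040 := by
  have : Fact (Nat.Prime 3121) := ⟨by norm_num⟩
  have : Fact (Nat.Prime 7) := ⟨by norm_num⟩
  have : Fact (Nat.Prime 23) := ⟨by norm_num⟩
  obtain ⟨k, _, _, φ, hφt, hφa, -⟩ :=
    exists_frobenius_fixing ha ht hF 3121 256 447 (by norm_num) (by norm_num)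
  obtain ⟨z', hz', hφz, hzz⟩ := exists_numbering φ hz
    (intCast_injective_of_emod (k := k) splitRoots_distinct) (fun i => by
      rw [hφa, hφt]; exact_mod_cast cast_dodecic_splitRoots i)
  obtain ⟨w', hw', hφw, hww⟩ := exists_numbering φ hw
    (intCast_injective_of_emod (k := k) splitConjRoots_distinct) (fun i => by
      simpa [hφa, hφt] using cast_dodecic_splitConjRoots (k := k) i)
  have hzinj : Function.Injective z' := by
    intro i j hij
    apply intCast_injective_of_emod (k := k) splitRoots_distinct
    simp only [← hφz, hij]
  have hwinj : Function.Injective w' := by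
    intro i j hij
    apply intCast_injective_of_emod (k := k) splitConjRoots_distinct
    simp only [← hφw, hij]
  have hstab : ∀ g : MulAction.stabilizer G a, (g : G) • a = a := fun g => g.2
  obtain ⟨π, hπ⟩ := exists_perm_hom (H := MulAction.stabilizer G a) hzinj fun g i =>
    exists_smul_root ht hz' (g : G) (hstab g) i
  obtain ⟨ρ, hρ⟩ := exists_perm_hom (H := MulAction.stabilizer G a) hwinj fun g i =>
    exists_smul_root ht hw' (g : G) (by rw [smul_neg, hstab g]) i
  have hrel := cross_ratio_relation φ ha (by rw [hφa, Nat.cast_ofNat])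
    (dodecic_eq_zero_of_prod_eq hz') (dodecic_eq_zero_of_prod_eq hw') hφz hφw
  have hfrob : ∀ (p : ℕ) [Fact p.Prime] (a₀ t₀ : ℕ), (a₀ ^ 2 + 5) % p = 0 → (2 * a₀) % p ≠ 0 →
      HasFrobenius π.range p a₀ t₀ := by
    intro p _ a₀ t₀ h1 h2
    obtain ⟨k', i1, i2, φ', hφt', hφa', g, hga, hg⟩ :=
      exists_frobenius_fixing ha ht hF p a₀ t₀ h1 h2
    refine ⟨k', i1, i2, φ' ∘ z', ?_, π ⟨g, hga⟩, ⟨_, rfl⟩, fun i => ?_⟩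
    · rw [← hφt', ← hφa']
      exact prod_map_eq φ' hz'
    · have := hπ ⟨g, hga⟩ i
      rw [Function.comp_apply, Function.comp_apply, ← hg, ← this]
      rfl
  refine card_eq_of_cycleData (π := π) (ρ := ρ) ?_ ?_ ?_
  · intro g i l j m
    obtain ⟨h1, h2⟩ := hrel i l j m
    obtain ⟨h3, h4⟩ := hrel (π g i) (π g l) (ρ g j) (ρ g m)
    have hN : ∀ i j, rootNum a (z' (π g i)) (w' (ρ g j)) = (g : G) • rootNum a (z' i) (w' j) := by
      intro i j
      rw [← hπ, ← hρ]
      exact ((smul_rootNum_rootDen (g : G) (hstab g) _ _).1).symm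
    have hD : ∀ i j, rootDen a (z' (π g i)) (w' (ρ g j)) = (g : G) • rootDen a (z' i) (w' j) := by
      intro i j
      rw [← hπ, ← hρ]
      exact ((smul_rootNum_rootDen (g : G) (hstab g) _ _).2).symm
    have h5 := congrArg (MulSemiringAction.toRingHom G B (g : G)) h1
    rw [map_mul (MulSemiringAction.toRingHom G B (g : G)) (Int.cast _) _, map_intCast] at h5
    simp only [MulSemiringAction.toRingHom_apply, smul_mul'] at h5
    simp only [← hN, ← hD] at h5
    rw [h3] at h5
    have h6 := congrArg φ (mul_right_cancel₀ (fun h => h4 (by rw [h, map_zero])) h5)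
    rw [map_intCast, map_intCast] at h6
    have hunit : ∀ i j, hadamard i j = 1 ∨ hadamard i j = -1 := fun i j =>
      mul_self_eq_one_iff.1 (hadamard_sq i j)
    have hsign : ∀ i l j m, hadamard i j * hadamard l m * (hadamard i m * hadamard l j) = 1 ∨
        hadamard i j * hadamard l m * (hadamard i m * hadamard l j) = -1 := by
      intro i l j m
      rcases hunit i j with h | h <;> rcases hunit l m with h' | h' <;>
        rcases hunit i m with h'' | h'' <;> rcases hunit l j with h3 | h3 <;>
          simp [h, h', h'', h3]
    have h7 : (1 : k) ≠ -1 := by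
      intro h
      have : ((2 : ℕ) : k) = 0 := by push_cast; linear_combination h
      rw [CharP.cast_eq_zero_iff k 3121] at this
      omega
    rcases hsign i l j m with h | h <;>
      rcases hsign (π g i) (π g l) (ρ g j) (ρ g m) with h' | h' <;> rw [h, h'] at h6 ⊢
    · simp only [Int.cast_one, Int.cast_neg] at h6
      exact absurd h6.symm h7
    · simp only [Int.cast_one, Int.cast_neg] at h6
      exact absurd h6 h7
  · intro g h1 h2
    apply Subtype.ext
    refine hfaith _ (fun i => ?_) fun j => ?_
    · obtain ⟨j, hj⟩ := hzz i
      have := hπ g j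
      rw [h1, Equiv.Perm.one_apply] at this
      rw [hj]
      exact this
    · obtain ⟨l, hl⟩ := hww j
      have := hρ g l
      rw [h2, Equiv.Perm.one_apply] at this
      rw [hl]
      exact this
  · exact
      { eleven := exists_cycle_eleven (hfrob 7 4 2 (by norm_num) (by norm_num))
        ten := exists_cycle_ten (hfrob 23 8 14 (by norm_num) (by norm_num))
        eight := exists_cycle_eight (hfrob 7 4 6 (by norm_num) (by norm_num))
        six := exists_cycle_six (hfrob 7 4 4 (by norm_num) (by norm_num)) }

theorem card_group_eq [Finite G] {a t : B} (ha : a ^ 2 = -5) (ht : ∀ g : G, g • t = t)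
    (hF : HasFrobenii G t) {z w : Fin 12 → B}
    (hz : ∏ i, (X - C (z i)) = dodecic (C a) (C t) X)
    (hw : ∏ j, (X - C (w j)) = dodecic (C (-a)) (C t) X)
    (hfaith : ∀ g : G, (∀ i, g • z i = z i) → (∀ j, g • w j = w j) → g = 1) :
    Nat.card G = 190080 := by
  have hne := exists_smul_eq_neg (G := G) ha hF
  obtain ⟨s, hs⟩ := hne.2
  have horb : MulAction.orbit G a = {a, -a} := by
    ext b
    simp only [MulAction.mem_orbit_iff, Set.mem_insert_iff, Set.mem_singleton_iff]
    constructor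
    · rintro ⟨g, rfl⟩
      exact smul_eq_or_eq_neg ha g
    · rintro (rfl | rfl)
      · exact ⟨1, one_smul _ _⟩
      · exact ⟨s, hs⟩
  rw [← (MulAction.stabilizer G a).card_mul_index, MulAction.index_stabilizer, horb,
    Set.ncard_pair hne.1, card_stabilizer_eq ha ht hF hz hw hfaith]

end GroupOrder

section IntegralClosure

variable {A F L : Type} [CommRing A] [IsIntegrallyClosed A] [Field F] [Field L]
  [Algebra A F] [IsFractionRing A F] [Algebra F L] [Algebra A L] [IsScalarTower A F L]

theorem isInvariant_integralClosure [SMulCommClass Gal(L/F) A L] [FiniteDimensional F L]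
    [IsGalois F L] : Algebra.IsInvariant A (integralClosure A L) Gal(L/F) := by
  refine ⟨fun b hb => ?_⟩
  have h1 : ∀ g : Gal(L/F), g (b : L) = b := fun g => congrArg Subtype.val (hb g)
  obtain ⟨x, hx⟩ := IsGalois.mem_range_algebraMap_iff_fixed (F := F) (b : L) |>.2 h1
  have h2 : IsIntegral A x := by
    rw [← isIntegral_algebraMap_iff (algebraMap F L).injective, hx]
    exact b.2
  obtain ⟨y, rfl⟩ := IsIntegrallyClosed.isIntegral_iff.1 h2
  refine ⟨y, Subtype.ext ?_⟩
  rw [← hx, ← IsScalarTower.algebraMap_apply A F L]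
  rfl

end IntegralClosure

section Monic

variable {R : Type} [CommRing R] [Nontrivial R]

theorem monic_quartic (a : R) :
    (quartic (C a) X : R[X]).Monic ∧ (quartic (C a) X : R[X]).natDegree = 4 := by
  have h : (quartic (C a) X : R[X]) = X ^ 4 + C 300 * X ^ 3 + C (25 * (870 - 24 * a)) * X ^ 2 +
      C (125 * (220 - 16 * a)) * X + C (625 * (648 * a - 6399)) := by
    simp [quartic, map_ofNat]
  rw [h]
  exact ⟨by monicity!, by compute_degree!⟩

theorem monic_dodecic (a t : R) :
    (dodecic (C a) (C t) X : R[X]).Monic ∧ (dodecic (C a) (C t) X : R[X]).natDegree = 12 := by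
  obtain ⟨h1, h2⟩ := monic_quartic a
  have h3 : (quartic (C a) X ^ 3 : R[X]).Monic := h1.pow 3
  have h4 : (quartic (C a) X ^ 3 : R[X]).natDegree = 12 := by rw [h1.natDegree_pow, h2]
  have h5 : (dodecic (C a) (C t) X : R[X]) = quartic (C a) X ^ 3 +
      C (2 ^ 12 * 3 ^ 15 * 5 ^ 7 * (118 * a - 475) * t) * X ^ 2 := by
    simp [dodecic, map_ofNat]
  have h6 : (C (2 ^ 12 * 3 ^ 15 * 5 ^ 7 * (118 * a - 475) * t) * X ^ 2 : R[X]).degree <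
      (quartic (C a) X ^ 3 : R[X]).degree := by
    rw [degree_eq_natDegree h3.ne_zero, h4]
    exact (degree_C_mul_X_pow_le 2 _).trans_lt (by norm_num)
  rw [h5]
  refine ⟨h3.add_of_left h6, ?_⟩
  rw [natDegree_add_eq_left_of_degree_lt h6, h4]

end Monic

section GaloisGroup

variable {F L : Type} [Field F] [CharZero F] [Field L] [Algebra ℤ[X] F] [IsFractionRing ℤ[X] F]
  [Algebra F L] [Algebra ℤ[X] L] [IsScalarTower ℤ[X] F L] [FiniteDimensional F L] [IsGalois F L]

theorem hasFrobenii_integralClosure [SMulCommClass Gal(L/F) ℤ[X] L] :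
    HasFrobenii Gal(L/F) (algebraMap ℤ[X] (integralClosure ℤ[X] L) X) := by
  intro p _ t₀
  have : Algebra.IsInvariant ℤ[X] (integralClosure ℤ[X] L) Gal(L/F) := isInvariant_integralClosure
  have : Module.Finite ℤ[X] (integralClosure ℤ[X] L) :=
    IsIntegralClosure.finite ℤ[X] F L (integralClosure ℤ[X] L)
  have hinj : Function.Injective (algebraMap ℤ[X] L) := by
    rw [IsScalarTower.algebraMap_eq ℤ[X] F L]
    exact (algebraMap F L).injective.comp (IsFractionRing.injective ℤ[X] F)
  have : FaithfulSMul ℤ[X] (integralClosure ℤ[X] L) := by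
    rw [faithfulSMul_iff_algebraMap_injective]
    intro x y hxy
    exact hinj (congrArg Subtype.val hxy)
  have : SMulCommClass Gal(L/F) ℤ[X] (integralClosure ℤ[X] L) :=
    ⟨fun g x b => Subtype.ext (smul_comm g x (b : L))⟩
  obtain ⟨k, i1, i2, φ, hφ, hg⟩ := exists_reduction_and_frobenius (G := Gal(L/F))
    (B := integralClosure ℤ[X] L) p (eval₂RingHom (Int.castRingHom (ZMod p)) (t₀ : ZMod p))
  refine ⟨k, i1, i2, φ, ?_, hg⟩
  rw [hφ]
  simp

theorem card_gal_eq {α : L} (hα : α ^ 2 = -5) {z w : Fin 12 → L}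
    (hz : ∏ i, (X - C (z i)) = dodecic (C α) (C (algebraMap ℤ[X] L X)) X)
    (hw : ∏ j, (X - C (w j)) = dodecic (C (-α)) (C (algebraMap ℤ[X] L X)) X)
    (hfaith : ∀ g : Gal(L/F), (∀ i, g (z i) = z i) → (∀ j, g (w j) = w j) → g = 1) :
    Nat.card Gal(L/F) = 190080 := by
  have : SMulCommClass Gal(L/F) ℤ[X] L := ⟨fun g x b => by
    rw [← algebraMap_smul F x b, ← algebraMap_smul F x (g • b)]
    exact smul_comm g _ b⟩
  set B := integralClosure ℤ[X] L
  have hα' : IsIntegral ℤ[X] α := by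
    refine IsIntegral.of_pow (n := 2) (by norm_num) ?_
    rw [hα]
    exact by
      simpa only [map_neg, map_ofNat] using isIntegral_algebraMap (R := ℤ[X]) (A := L) (x := -5)
  obtain ⟨a, ha⟩ : ∃ a : B, (a : L) = α := ⟨⟨α, hα'⟩, rfl⟩
  have hintegral : ∀ (a : B) (x : L), dodecic (a : L) (algebraMap ℤ[X] L X) x = 0 → ∃ y : B,
      (y : L) = x := by
    intro a x hx
    have hx' : IsIntegral B x := by
      refine ⟨dodecic (C a) (C (algebraMap ℤ[X] B X)) X, (monic_dodecic _ _).1, ?_⟩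
      rw [← coe_eval₂RingHom, map_dodecic]
      simpa using hx
    exact ⟨⟨x, isIntegral_trans (R := ℤ[X]) x hx'⟩, rfl⟩
  have hroot : ∀ {b : L} {z : Fin 12 → L}, (∏ i, (X - C (z i)) =
      dodecic (C b) (C (algebraMap ℤ[X] L X)) X) → ∀ i, dodecic b (algebraMap ℤ[X] L X) (z i) =
      0 := fun h i => dodecic_eq_zero_of_prod_eq h i
  choose z' hz' using fun i => hintegral a (z i) (by rw [ha]; exact hroot hz i)
  choose w' hw' using fun i => hintegral (-a) (w i) (by push_cast; rw [ha]; exact hroot hw i)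
  have hlift : ∀ (b : B) (z' : Fin 12 → B), (∏ i, (X - C (z' i : L)) =
      dodecic (C (b : L)) (C (algebraMap ℤ[X] L X)) X) → ∏ i, (X - C (z' i)) =
      dodecic (C b) (C (algebraMap ℤ[X] B X)) X := by
    intro b z' h
    apply Polynomial.map_injective (algebraMap B L) Subtype.val_injective
    refine Eq.trans ?_ (map_dodecic (mapRingHom (algebraMap B L)) (C b)
      (C (algebraMap ℤ[X] B X)) X).symm
    rw [← coe_mapRingHom, map_prod]
    simpa using h
  refine card_group_eq (G := Gal(L/F)) (B := B) (a := a) (t := algebraMap ℤ[X] B X) (z := z') (w :=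
      w') ?_ ?_ hasFrobenii_integralClosure ?_ ?_ ?_
  · apply Subtype.ext
    push_cast
    rw [ha, hα]
    rfl
  · intro g
    apply Subtype.ext
    rw [integralClosure.coe_smul]
    change g (algebraMap ℤ[X] L X) = algebraMap ℤ[X] L X
    rw [IsScalarTower.algebraMap_apply ℤ[X] F L, g.commutes]
  · apply hlift
    simpa only [hz', ha] using hz
  · apply hlift
    push_cast
    simpa only [hw', ha] using hw
  · intro g h1 h2
    refine hfaith g (fun i => ?_) fun j => ?_
    · rw [← hz']
      exact congrArg Subtype.val (h1 i)
    · rw [← hw']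
      exact congrArg Subtype.val (h2 j)

end GaloisGroup

section NormForm

variable {R S : Type} [CommRing R] [CommRing S]

/-- The form `f_A` in its original normalization. -/
def originalForm (a t x : R) : R :=
  5 ^ 3 * (24 * a * x ^ 2 + 16 * a * x - 648 * a - x ^ 4 - 60 * x ^ 3
      - 870 * x ^ 2 - 220 * x + 6399) ^ 3
    - 2 ^ 12 * 3 ^ 15 * (118 * a - 475) * t * x ^ 2

/-- The norm of `f_A` from `ℚ(√-5)` to `ℚ`, as a form with integer coefficients. -/
def normForm (t x : R) : R :=
  (5 ^ 3 * ((-x ^ 4 - 60 * x ^ 3 - 870 * x ^ 2 - 220 * x + 6399) ^ 3 -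
      15 * (-x ^ 4 - 60 * x ^ 3 - 870 * x ^ 2 - 220 * x + 6399) *
        (24 * x ^ 2 + 16 * x - 648) ^ 2) + 2 ^ 12 * 3 ^ 15 * 475 * t * x ^ 2) ^ 2 +
    5 * (5 ^ 3 * (3 * (-x ^ 4 - 60 * x ^ 3 - 870 * x ^ 2 - 220 * x + 6399) ^ 2 *
        (24 * x ^ 2 + 16 * x - 648) - 5 * (24 * x ^ 2 + 16 * x - 648) ^ 3) -
      2 ^ 12 * 3 ^ 15 * 118 * t * x ^ 2) ^ 2

theorem map_originalForm (f : R →+* S) (a t x : R) :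
    f (originalForm a t x) = originalForm (f a) (f t) (f x) := by
  simp [originalForm, map_ofNat]

theorem map_normForm (f : R →+* S) (t x : R) : f (normForm t x) = normForm (f t) (f x) := by
  simp [normForm, map_ofNat]

theorem originalForm_mul_conj {a : R} (ha : a ^ 2 = -5) (t x : R) :
    originalForm a t x * originalForm (-a) t x = normForm t x := by
  have key : ∀ b : R, b ^ 2 = -5 → originalForm b t x =
      (5 ^ 3 * ((-x ^ 4 - 60 * x ^ 3 - 870 * x ^ 2 - 220 * x + 6399) ^ 3 -
      15 * (-x ^ 4 - 60 * x ^ 3 - 870 * x ^ 2 - 220 * x + 6399) *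
        (24 * x ^ 2 + 16 * x - 648) ^ 2) + 2 ^ 12 * 3 ^ 15 * 475 * t * x ^ 2) +
      b * (5 ^ 3 * (3 * (-x ^ 4 - 60 * x ^ 3 - 870 * x ^ 2 - 220 * x + 6399) ^ 2 *
        (24 * x ^ 2 + 16 * x - 648) - 5 * (24 * x ^ 2 + 16 * x - 648) ^ 3) -
      2 ^ 12 * 3 ^ 15 * 118 * t * x ^ 2) := by
    intro b hb
    rw [originalForm]
    generalize hm : -x ^ 4 - 60 * x ^ 3 - 870 * x ^ 2 - 220 * x + 6399 = m
    generalize hl : 24 * x ^ 2 + 16 * x - 648 = l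
    have h1 : 24 * b * x ^ 2 + 16 * b * x - 648 * b - x ^ 4 - 60 * x ^ 3 - 870 * x ^ 2 - 220 * x
        + 6399 = b * l + m := by
      rw [← hm, ← hl]; ring
    rw [h1]
    linear_combination 125 * (b * l ^ 3 + 3 * l ^ 2 * m) * hb
  rw [key a ha, key (-a) (by rw [neg_sq, ha]), normForm]
  generalize 5 ^ 3 * ((-x ^ 4 - 60 * x ^ 3 - 870 * x ^ 2 - 220 * x + 6399) ^ 3 -
      15 * (-x ^ 4 - 60 * x ^ 3 - 870 * x ^ 2 - 220 * x + 6399) *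
        (24 * x ^ 2 + 16 * x - 648) ^ 2) + 2 ^ 12 * 3 ^ 15 * 475 * t * x ^ 2 = u
  generalize 5 ^ 3 * (3 * (-x ^ 4 - 60 * x ^ 3 - 870 * x ^ 2 - 220 * x + 6399) ^ 2 *
        (24 * x ^ 2 + 16 * x - 648) - 5 * (24 * x ^ 2 + 16 * x - 648) ^ 3) -
      2 ^ 12 * 3 ^ 15 * 118 * t * x ^ 2 = v
  linear_combination -v ^ 2 * ha

theorem originalForm_rescale (a t x : R) :
    5 ^ 12 * originalForm a t x = -125 * dodecic a t (5 * x) := by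
  rw [originalForm, dodecic, quartic]
  have h1 : (5 * x) ^ 4 + 300 * (5 * x) ^ 3 + 25 * (870 - 24 * a) * (5 * x) ^ 2 +
      125 * (220 - 16 * a) * (5 * x) + 625 * (648 * a - 6399) =
      -625 * (24 * a * x ^ 2 + 16 * a * x - 648 * a - x ^ 4 - 60 * x ^ 3
      - 870 * x ^ 2 - 220 * x + 6399) := by ring
  rw [h1]
  generalize 24 * a * x ^ 2 + 16 * a * x - 648 * a - x ^ 4 - 60 * x ^ 3
      - 870 * x ^ 2 - 220 * x + 6399 = u
  ring

end NormForm

theorem exists_fin_prod_map_eq {α M : Type} [CommMonoid M] {n : ℕ} (s : Multiset α)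
    (hs : s.card = n) : ∃ z : Fin n → α, ∀ f : α → M, ∏ i, f (z i) = (s.map f).prod := by
  induction s using Quotient.inductionOn with
  | h l =>
    obtain rfl : l.length = n := hs
    exact ⟨fun i => l[i.1], fun f => by simp⟩

section Roots

variable {L : Type} [Field L] [CharZero L]

theorem dodecic_eq_zero_iff (a t x : L) : dodecic a t (5 * x) = 0 ↔ originalForm a t x = 0 := by
  have h := originalForm_rescale a t x
  constructor
  · intro h0
    rw [h0, mul_zero] at h
    exact (mul_eq_zero.1 h).resolve_left (by norm_num)
  · intro h0
    rw [h0, mul_zero] at h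
    exact (mul_eq_zero.1 h.symm).resolve_left (by norm_num)

theorem exists_prod_of_splits {a t : L} (ha : a ^ 2 = -5)
    (h : (normForm (C t) X : L[X]).Splits) :
    ∃ z : Fin 12 → L, ∏ i, (X - C (z i)) = dodecic (C a) (C t) X := by
  have hm := monic_dodecic a t
  have hm' := monic_dodecic (-a) t
  have hscale : ∀ b : L, (originalForm (C b) (C t) X : L[X]).comp (C (1 / 5) * X) =
      C (-125 / 5 ^ 12) * dodecic (C b) (C t) X := by
    intro b
    have h1 := congrArg (compRingHom (C (1 / 5) * X)) (originalForm_rescale (C b) (C t) X)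
    rw [map_mul, map_mul, map_dodecic] at h1
    have h2 : compRingHom (C (1 / 5 : L) * X) (5 * X) = X := by
      rw [map_mul, map_ofNat, coe_compRingHom_apply, X_comp, ← mul_assoc,
        ← map_ofNat (C : L →+* L[X]) 5, ← C_mul]
      norm_num
    rw [h2] at h1
    have h3 : (5 ^ 12 : L[X]) ≠ 0 := by simp
    apply mul_left_cancel₀ h3
    simp only [map_pow, map_ofNat, map_neg, coe_compRingHom, C_comp] at h1
    rw [h1, ← mul_assoc]
    congr 1
    rw [← map_ofNat (C : L →+* L[X]) 5, ← map_ofNat (C : L →+* L[X]) 125, ← C_neg, ← C_pow, ← C_mul]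
    congr 1
    field_simp
  have hs : (dodecic (C a) (C t) X : L[X]).Splits := by
    have h1 := h.comp_of_degree_le_one (g := C (1 / 5) * X) (degree_C_mul_X_le _)
    rw [← originalForm_mul_conj (a := C a) (by rw [← C_pow, ha]; simp [map_ofNat]), mul_comp,
        ← C_neg,
      hscale, hscale] at h1
    have hc : (C (-125 / 5 ^ 12 : L)) ≠ 0 := by simp
    refine h1.of_dvd (mul_ne_zero (mul_ne_zero hc hm.1.ne_zero) (mul_ne_zero hc hm'.1.ne_zero)) ?_
    exact Dvd.intro_left _ rfl |>.mul_right _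
  obtain ⟨z, hz⟩ := exists_fin_prod_map_eq (M := L[X]) (dodecic (C a) (C t) X : L[X]).roots
    (n := 12) (by rw [← hs.natDegree_eq_card_roots, hm.2])
  exact ⟨z, (hz fun r => X - C r).trans (hs.eq_prod_roots_of_monic hm.1).symm⟩

theorem exists_root_of_originalForm {a t : L} {z : Fin 12 → L}
    (hz : ∏ i, (X - C (z i)) = dodecic (C a) (C t) X) {x : L} (hx : originalForm a t x = 0) :
    ∃ i, x = z i / 5 := by
  obtain ⟨i, hi⟩ := exists_root_eq hz ((dodecic_eq_zero_iff a t x).2 hx)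
  exact ⟨i, by rw [← hi]; field_simp⟩

end Roots

section SplittingField

variable {F L : Type} [Field F] [Field L] [Algebra F L]

theorem aeval_normForm {a : L} (ha : a ^ 2 = -5) (t : F) (x : L) :
    aeval x (normForm (C t) X) =
      originalForm a (algebraMap F L t) x * originalForm (-a) (algebraMap F L t) x := by
  rw [originalForm_mul_conj ha, aeval_def, ← coe_eval₂RingHom, map_normForm]
  simp

theorem normForm_ne_zero {F : Type} [Field F] [CharZero F] (t : F) :
    (normForm (C t) X : F[X]) ≠ 0 := by
  intro h
  have := congrArg (evalRingHom 0) h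
  rw [map_normForm] at this
  norm_num [normForm] at this

theorem isSplittingField_normForm [CharZero F] [CharZero L] {a : L} (ha : a ^ 2 = -5) (t : F)
    [hL : IsSplittingField F L (normForm (C t) X * (X ^ 2 + 5))] :
    IsSplittingField F L (normForm (C t) X) := by
  have h0 : ((X ^ 2 + 5 : F[X])) ≠ 0 := (by monicity! : (X ^ 2 + C 5 : F[X]).Monic).ne_zero
  have hs : ((normForm (C t) X : F[X]).map (algebraMap F L)).Splits := by
    refine (IsSplittingField.splits L (normForm (C t) X * (X ^ 2 + 5))).of_dvd ?_ ?_
    · exact Polynomial.map_ne_zero (mul_ne_zero (normForm_ne_zero t) h0)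
    · exact Polynomial.map_dvd _ (dvd_mul_right _ _)
  refine isSplittingField_iff_intermediateField.2 ⟨hs, ?_⟩
  set E := IntermediateField.adjoin F ((normForm (C t) X : F[X]).rootSet L) with hE
  have hroot : ∀ x : L, aeval x (normForm (C t) X : F[X]) = 0 → x ∈ E := fun x hx =>
    IntermediateField.subset_adjoin _ _ ((mem_rootSet.2 ⟨normForm_ne_zero t, hx⟩))
  rw [← coe_mapRingHom, map_normForm] at hs
  simp only [coe_mapRingHom, map_C, map_X] at hs
  obtain ⟨z, hz⟩ := exists_prod_of_splits ha hs
  have hzE : ∀ i, z i ∈ E := by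
    intro i
    have h1 : z i / 5 ∈ E := by
      apply hroot
      rw [aeval_normForm ha, (dodecic_eq_zero_iff a _ _).1, zero_mul]
      rw [mul_div_cancel₀ _ (by norm_num)]
      exact dodecic_eq_zero_of_prod_eq hz i
    have h2 := mul_mem h1 (ofNat_mem E 5)
    rwa [div_mul_cancel₀ _ (by norm_num)] at h2
  have haE : a ∈ E := by
    have h1 := congrArg (evalRingHom 0) hz
    rw [map_dodecic, map_prod] at h1
    simp only [coe_evalRingHom, eval_sub, eval_X, eval_C, zero_sub] at h1
    have h2 : ∏ i, -z i ∈ E := prod_mem fun i _ => neg_mem (hzE i)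
    have h3 : a = ((∏ i, -z i) / 625 ^ 3 + 6399 ^ 3 - 15 * 6399 * 648 ^ 2) /
        (3 * 648 * 6399 ^ 2 - 5 * 648 ^ 3) := by
      have h4 : dodecic a (algebraMap F L t) 0 / 625 ^ 3 = (648 * a - 6399) ^ 3 := by
        rw [dodecic, quartic]
        ring
      rw [h1, eq_div_iff (by norm_num), h4]
      linear_combination (-(648 ^ 3 * a - 3 * 648 ^ 2 * 6399)) * ha
    rw [h3]
    have hn : ∀ n : ℕ, (n : L) ∈ E := natCast_mem E
    have h5 := div_mem (sub_mem (add_mem (div_mem h2 (hn (625 ^ 3))) (hn (6399 ^ 3)))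
      (hn (15 * 6399 * 648 ^ 2))) (sub_mem (hn (3 * 648 * 6399 ^ 2)) (hn (5 * 648 ^ 3)))
    norm_num at h5 ⊢
    exact h5
  rw [eq_top_iff, ← (isSplittingField_iff_intermediateField.1 hL).2,
      IntermediateField.adjoin_le_iff]
  intro x hx
  have h1 := (mem_rootSet.1 hx).2
  rw [map_mul, mul_eq_zero] at h1
  rcases h1 with h1 | h1
  · exact hroot x h1
  · have h2 : x ^ 2 = a ^ 2 := by
      rw [ha]
      simpa [eq_neg_iff_add_eq_zero, map_ofNat] using h1
    rcases sq_eq_sq_iff_eq_or_eq_neg.1 h2 with h | h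
    · rw [h]; exact haE
    · rw [h]; exact neg_mem haE

end SplittingField

section Main

theorem card_gal_normForm [Algebra ℤ[X] (RatFunc ℚ)] (h : algebraMap ℤ[X] (RatFunc ℚ) =
      (algebraMap ℚ[X] (RatFunc ℚ)).comp (mapRingHom (Int.castRingHom ℚ))) :
    Nat.card (normForm (C RatFunc.X) X : (RatFunc ℚ)[X]).Gal = 190080 := by
  have := isFractionRing_int_polynomial h
  have hX : algebraMap ℤ[X] (RatFunc ℚ) X = RatFunc.X := by
    rw [h]
    simp
  let L := ((normForm (C RatFunc.X) X : (RatFunc ℚ)[X]) * (X ^ 2 + 5)).SplittingField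
  have : CharZero L := charZero_of_injective_algebraMap (algebraMap (RatFunc ℚ) L).injective
  obtain ⟨a, ha⟩ : ∃ a : L, a ^ 2 = -5 := by
    have h0 : (X ^ 2 + 5 : (RatFunc ℚ)[X]).Monic :=
      (by monicity! : (X ^ 2 + C 5 : (RatFunc ℚ)[X]).Monic)
    have h1 : ((X ^ 2 + 5 : (RatFunc ℚ)[X]).map (algebraMap (RatFunc ℚ) L)).Splits :=
      (SplittingField.splits ((normForm (C RatFunc.X) X : (RatFunc ℚ)[X]) * (X ^ 2 + 5))).of_dvd
        (Polynomial.map_ne_zero (mul_ne_zero (normForm_ne_zero _) h0.ne_zero))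
        (Polynomial.map_dvd _ (dvd_mul_left _ _))
    obtain ⟨a, ha⟩ := h1.exists_eval_eq_zero (by
      have h2 : (X ^ 2 + C 5 : (RatFunc ℚ)[X]).degree = 2 := by compute_degree!
      rw [degree_map, ← map_ofNat (C : RatFunc ℚ →+* (RatFunc ℚ)[X]) 5, h2]
      norm_num)
    refine ⟨a, eq_neg_of_add_eq_zero_left ?_⟩
    simpa using ha
  have hS : IsSplittingField (RatFunc ℚ) L (normForm (C RatFunc.X) X) :=
    isSplittingField_normForm ha _
  have : FiniteDimensional (RatFunc ℚ) L := 
    IsSplittingField.finiteDimensional L (normForm (C RatFunc.X) X : (RatFunc ℚ)[X])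
  have : Normal (RatFunc ℚ) L := Normal.of_isSplittingField (normForm (C RatFunc.X) X)
  have : IsGalois (RatFunc ℚ) L := IsGalois.mk
  have hXL : algebraMap ℤ[X] L X = algebraMap (RatFunc ℚ) L RatFunc.X := by
    rw [IsScalarTower.algebraMap_apply ℤ[X] (RatFunc ℚ) L, hX]
  have hs := hS.splits'
  rw [← coe_mapRingHom, map_normForm] at hs
  simp only [coe_mapRingHom, map_C, map_X] at hs
  rw [← hXL] at hs
  obtain ⟨z, hz⟩ := exists_prod_of_splits ha hs
  obtain ⟨w, hw⟩ := exists_prod_of_splits (a := -a) (by rw [neg_sq, ha]) hs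
  refine (Nat.card_congr (AlgEquiv.autCongr (IsSplittingField.algEquiv L
    (normForm (C RatFunc.X) X : (RatFunc ℚ)[X]))).symm.toEquiv).trans ?_
  refine card_gal_eq ha hz hw fun g h1 h2 => ?_
  apply AlgEquiv.coe_toAlgHom_injective
  refine AlgHom.ext_of_adjoin_eq_top (IsSplittingField.adjoin_rootSet L
    (normForm (C RatFunc.X) X : (RatFunc ℚ)[X])) fun x hx => ?_
  have h3 := (mem_rootSet.1 hx).2
  rw [aeval_normForm ha, ← hXL, mul_eq_zero] at h3
  change g x = x
  rcases h3 with h3 | h3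
  · obtain ⟨i, rfl⟩ := exists_root_of_originalForm hz h3
    rw [map_div₀, h1, map_ofNat]
  · obtain ⟨i, rfl⟩ := exists_root_of_originalForm hw h3
    rw [map_div₀, h2, map_ofNat]

end Main

/-- Let `K = ℚ(√-5)`, `a = √-5`, and `σ` the nontrivial automorphism of `K/ℚ`.
The polynomial `f_{A2} = f_A · σf_A` has coefficients in `ℚ(t)` and its Galois group over `ℚ(t)`
has order `190080`, the order of `M₁₂.2 = Aut(M₁₂)`. -/
theorem galois_group_of_fA2_has_card_M12_2 (K : Type) [Field K] [Algebra ℚ K]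
    (a : K) (ha : a ^ 2 = -5) (hgen : IntermediateField.adjoin ℚ {a} = ⊤)
    (σ : K ≃ₐ[ℚ] K) (hσ : σ a = -a) :
    -- the extension of `σ` to `K(t)` fixing `t`, used to conjugate coefficients
    let sigmaT : RatFunc K →+* RatFunc K :=
      RatFunc.mapRingHom (Polynomial.mapRingHom (σ : K →+* K))
        (nonZeroDivisors_le_comap_nonZeroDivisors_of_injective _
          (Polynomial.map_injective _ (RingHom.injective _)))
    -- the inclusion `ℚ(t) → K(t)`
    let ι : RatFunc ℚ →+* RatFunc K :=
      RatFunc.mapRingHom (Polynomial.mapRingHom (algebraMap ℚ K))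
        (nonZeroDivisors_le_comap_nonZeroDivisors_of_injective _
          (Polynomial.map_injective _ (RingHom.injective _)))
    let A : Polynomial (RatFunc K) := C (RatFunc.C a)
    let t : Polynomial (RatFunc K) := C RatFunc.X
    let fA : Polynomial (RatFunc K) :=
      5 ^ 3 * (24 * A * X ^ 2 + 16 * A * X - 648 * A - X ^ 4 - 60 * X ^ 3
          - 870 * X ^ 2 - 220 * X + 6399) ^ 3
        - 2 ^ 12 * 3 ^ 15 * (118 * A - 475) * t * X ^ 2
    let fA2 : Polynomial (RatFunc K) := fA * fA.map sigmaT
    ∃ g : Polynomial (RatFunc ℚ), g.map ι = fA2 ∧ Nat.card g.Gal = 190080 := by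
  intro sigmaT ι A t fA fA2
  let i1 : Algebra ℤ[X] (RatFunc ℚ) :=
    ((algebraMap ℚ[X] (RatFunc ℚ)).comp (mapRingHom (Int.castRingHom ℚ))).toAlgebra
  refine ⟨normForm (C RatFunc.X) X, ?_, card_gal_normForm rfl⟩
  have map_algebraMap : ∀ {k : Type} [Field k] (f : k →+* K) (hf) (q : k[X]),
      RatFunc.mapRingHom (mapRingHom f) hf (algebraMap k[X] (RatFunc k) q) =
        algebraMap K[X] (RatFunc K) (q.map f) := by
    intro k _ f hf q
    have := RatFunc.map_apply_div (mapRingHom f) hf q 1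
    simpa [RatFunc.coe_mapRingHom_eq_coe_map] using this
  have hιX : ι RatFunc.X = RatFunc.X := by
    rw [← RatFunc.algebraMap_X, map_algebraMap, map_X, RatFunc.algebraMap_X]
  have hσX : sigmaT RatFunc.X = RatFunc.X := by
    rw [← RatFunc.algebraMap_X, map_algebraMap, map_X]
  have hσC : sigmaT (RatFunc.C a) = -RatFunc.C a := by
    rw [← RatFunc.algebraMap_C, map_algebraMap, map_C]
    change algebraMap _ _ (C (σ a)) = _
    rw [hσ, C_neg, map_neg]
  have hA : A ^ 2 = -5 := by
    rw [← C_pow, ← map_pow, ha, map_neg, map_ofNat, map_neg, map_ofNat]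
  have hfA : fA = originalForm A t X := rfl
  have hconj : fA.map sigmaT = originalForm (-A) t X := by
    rw [hfA, ← coe_mapRingHom, map_originalForm, coe_mapRingHom, map_C, map_C, map_X, hσC, hσX,
        C_neg]
  change _ = fA * fA.map sigmaT
  rw [hconj, hfA, originalForm_mul_conj hA, ← coe_mapRingHom, map_normForm, coe_mapRingHom, map_C,
    map_X, hιX]
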